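/- arXiv:2207.11731 — 13 statements merged into one kernel-verified Lean document; each statement's English description precedes it below -/
import Mathlib

section
/- Let i, ī, n be positive integers with n+1 = i(ī+1). For all j₁, j₂ ∈ [1,ī] and a, b ∈ ℤ, if a − b ∈ S_{j₁,j₂,ī} then i(a−b) ∈ S_{ij₁,ij₂,n}. Consequently, if ω = ω_{j₁,a₁}⋯ω_{j_k,a_k} ∈ P_ī⁺ with a₁ ≤ ⋯ ≤ a_k is a prime snake, then Φ(ω) = ω_{ij₁,ia₁}⋯ω_{ij_k,ia_k} is a prime snake in P_n⁺. -/
/-- The set `S_{m,r,N} = {2q+2-m-r : max(m,r) ≤ q ≤ min(m+r-1, N)} ⊆ ℤ`. -/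
def Ssn (m r N : ℕ) : Set ℤ :=
  {x | ∃ q : ℕ, max m r ≤ q ∧ q ≤ min (m + r - 1) N ∧ x = 2 * (q : ℤ) + 2 - m - r}

/-- `ω = ω_{idx 1, a 1} ⋯ ω_{idx k, a k} ∈ P_N⁺` with `a 1 ≤ ⋯ ≤ a k` is a prime snake:
all indices lie in `[1,N]`, the `a`'s are weakly increasing, and
`a p - a (p-1) ∈ S_{idx p, idx (p-1), N}` for `2 ≤ p ≤ k`. -/
def IsPrimeSnake (N k : ℕ) (idx : ℕ → ℕ) (a : ℕ → ℤ) : Prop :=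
  (∀ t : ℕ, 1 ≤ t → t ≤ k → 1 ≤ idx t ∧ idx t ≤ N) ∧
  (∀ t : ℕ, 1 ≤ t → t + 1 ≤ k → a t ≤ a (t + 1)) ∧
  (∀ p : ℕ, 2 ≤ p → p ≤ k → a p - a (p - 1) ∈ Ssn (idx p) (idx (p - 1)) N)

theorem Ssn_scale (i ib n : ℕ) (hi : 1 ≤ i) (hrel : n + 1 = i * (ib + 1))
    (j₁ j₂ : ℕ) (h1 : 1 ≤ j₁) (x : ℤ) (hx : x ∈ Ssn j₁ j₂ ib) :
    (i : ℤ) * x ∈ Ssn (i * j₁) (i * j₂) n := by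
  obtain ⟨q, hq1, hq2, rfl⟩ := hx
  rw [max_le_iff] at hq1
  rw [le_min_iff] at hq2
  obtain ⟨ha, hb⟩ := hq1
  obtain ⟨hc, hd⟩ := hq2
  have e1 : i * j₁ ≤ i * q := Nat.mul_le_mul_left i ha
  have e2 : i * j₂ ≤ i * q := Nat.mul_le_mul_left i hb
  have e3 : i * (q + 1) ≤ i * (j₁ + j₂) := Nat.mul_le_mul_left i (by omega)
  have e4 : i * (q + 1) ≤ i * (ib + 1) := Nat.mul_le_mul_left i (by omega)
  have e5 : i * (q + 1) = i * q + i := by ring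
  have e6 : i * (j₁ + j₂) = i * j₁ + i * j₂ := by ring
  refine ⟨i * q + i - 1, max_le (by omega) (by omega), le_min (by omega) (by omega), ?_⟩
  rw [Nat.cast_sub (by omega)]
  push_cast
  ring

theorem stmt0 (i ib n : ℕ) (hi : 1 ≤ i) (hib : 1 ≤ ib) (hn : 1 ≤ n)
    (hrel : n + 1 = i * (ib + 1)) :
    (∀ j₁ j₂ : ℕ, 1 ≤ j₁ → j₁ ≤ ib → 1 ≤ j₂ → j₂ ≤ ib →
      ∀ a b : ℤ, a - b ∈ Ssn j₁ j₂ ib → (i : ℤ) * (a - b) ∈ Ssn (i * j₁) (i * j₂) n) ∧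
    (∀ (k : ℕ) (idx : ℕ → ℕ) (a : ℕ → ℤ), 1 ≤ k →
      IsPrimeSnake ib k idx a →
      IsPrimeSnake n k (fun t => i * idx t) (fun t => (i : ℤ) * a t)) := by
  refine ⟨fun j₁ j₂ h1 _ _ _ a b h => Ssn_scale i ib n hi hrel j₁ j₂ h1 _ h, ?_⟩
  rintro k idx a - ⟨hA, hB, hC⟩
  refine ⟨fun t h1 h2 => ?_, fun t h1 h2 => ?_, fun p h1 h2 => ?_⟩
  · obtain ⟨u, v⟩ := hA t h1 h2
    have e : i * idx t ≤ i * ib := Nat.mul_le_mul_left i v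
    have e' : i * (ib + 1) = i * ib + i := by ring
    exact ⟨Nat.mul_pos hi u, by show i * idx t ≤ n; omega⟩
  · exact mul_le_mul_of_nonneg_left (hB t h1 h2) (by positivity)
  · have := Ssn_scale i ib n hi hrel _ _ (hA p (by omega) h2).1 _ (hC p h1 h2)
    rw [mul_sub] at this
    exact this
end

section
/- Let n ≥ 1, i ∈ {1,…,n}, and let a = (a₁,…,a_r) and b = (b₁,…,b_m) be (i,n)-segments with r ≥ m. Then a and b are in general position if and only if at least one of the following holds: (a) b₁ − a_r > 2·min(i, n+1−i), or a₁ − b_m > 2·min(i, n+1−i), or b₁ − a₁ is odd; (b) {b₁,…,b_m} ⊆ {a₁,…,a_r}. -/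
/-- `S_{i,n} = {2j : 1 ≤ j ≤ min(i, n+1-i)} ⊆ ℤ`. -/
def Sseg (i n : ℕ) : Set ℤ :=
  {x | ∃ j : ℕ, 1 ≤ j ∧ j ≤ min i (n + 1 - i) ∧ x = 2 * (j : ℤ)}

/-- `(a 1, …, a r)` is an `(i,n)`-segment: consecutive differences lie in `S_{i,n}`. -/
def IsSeg (i n r : ℕ) (a : ℕ → ℤ) : Prop :=
  ∀ p : ℕ, 2 ≤ p → p ≤ r → a p - a (p - 1) ∈ Sseg i n

/-- Two `(i,n)`-segments `(a 1,…,a r)` and `(b 1,…,b s)` are in general position: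
there is no `(i,n)`-segment of length `> max r s` all of whose entries lie in the
union of the entries of `a` and of `b`. -/
def GenPos (i n r : ℕ) (a : ℕ → ℤ) (s : ℕ) (b : ℕ → ℤ) : Prop :=
  ¬ ∃ (t : ℕ) (c : ℕ → ℤ), max r s < t ∧ IsSeg i n t c ∧
      ∀ q : ℕ, 1 ≤ q → q ≤ t →
        ((∃ p : ℕ, 1 ≤ p ∧ p ≤ r ∧ a p = c q) ∨ (∃ p : ℕ, 1 ≤ p ∧ p ≤ s ∧ b p = c q))

theorem mem_Sseg (i n : ℕ) (x : ℤ) : x ∈ Sseg i n ↔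
    0 < x ∧ x ≤ 2 * ((min i (n + 1 - i) : ℕ) : ℤ) ∧ Even x := by
  unfold Sseg
  generalize min i (n + 1 - i) = M
  constructor
  · rintro ⟨j, h1, h2, rfl⟩
    refine ⟨by omega, by omega, by simp⟩
  · rintro ⟨h1, h2, y, hy⟩
    exact ⟨y.toNat, by omega, by omega, by omega⟩

theorem seg_lt {i n r : ℕ} {a : ℕ → ℤ} (ha : IsSeg i n r a) (p q : ℕ) (hp : 1 ≤ p)
    (hpq : p < q) (hq : q ≤ r) : a p < a q := by
  induction q, hpq using Nat.le_induction with
  | base =>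
    have := ((mem_Sseg _ _ _).1 (ha (p + 1) (by omega) hq)).1
    simp at this
    omega
  | succ k hk ih =>
    have := ((mem_Sseg _ _ _).1 (ha (k + 1) (by omega) hq)).1
    have h2 := ih (by omega)
    simp at this
    omega

theorem seg_le {i n r : ℕ} {a : ℕ → ℤ} (ha : IsSeg i n r a) (p q : ℕ) (hp : 1 ≤ p)
    (hpq : p ≤ q) (hq : q ≤ r) : a p ≤ a q := by
  rcases hpq.eq_or_lt with h | h
  · rw [h]
  · exact (seg_lt ha p q hp h hq).le

theorem seg_even {i n r : ℕ} {a : ℕ → ℤ} (ha : IsSeg i n r a) (q : ℕ) (hp : 1 ≤ q)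
    (hq : q ≤ r) : Even (a q - a 1) := by
  induction q, hp using Nat.le_induction with
  | base => simp
  | succ k hk ih =>
    have h1 := ((mem_Sseg _ _ _).1 (ha (k + 1) (by omega) hq)).2.2
    have h2 := ih (by omega)
    simp only [Nat.add_sub_cancel] at h1
    have := h1.add h2
    simpa using this

theorem seg_inj {i n r : ℕ} {a : ℕ → ℤ} (ha : IsSeg i n r a) :
    Set.InjOn a (Finset.Icc 1 r : Finset ℕ) := by
  intro p hp q hq h
  simp at hp hq
  rcases lt_trichotomy p q with h1 | h1 | h1
  · have := seg_lt ha p q hp.1 h1 hq.2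
    omega
  · exact h1
  · have := seg_lt ha q p hq.1 h1 hp.2
    omega

theorem seg_card {i n r : ℕ} {a : ℕ → ℤ} (ha : IsSeg i n r a) :
    ((Finset.Icc 1 r).image a).card = r := by
  rw [Finset.card_image_of_injOn (seg_inj ha)]
  simp

theorem seg_sub {i n r t : ℕ} {a c : ℕ → ℤ} (hc : IsSeg i n t c)
    (h : ∀ q, 1 ≤ q → q ≤ t → ∃ p, 1 ≤ p ∧ p ≤ r ∧ a p = c q) : t ≤ r := by
  have h1 : (Finset.Icc 1 t).image c ⊆ (Finset.Icc 1 r).image a := by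
    intro x hx
    simp only [Finset.mem_image, Finset.mem_Icc] at hx ⊢
    obtain ⟨q, hq, rfl⟩ := hx
    obtain ⟨p, h1, h2, h3⟩ := h q hq.1 hq.2
    exact ⟨p, ⟨h1, h2⟩, h3⟩
  have h2 := Finset.card_le_card h1
  rw [seg_card hc] at h2
  have h3 : ((Finset.Icc 1 r).image a).card ≤ (Finset.Icc 1 r).card := Finset.card_image_le
  simp only [Nat.card_Icc] at h3
  omega

theorem seg_split {i n t : ℕ} {c : ℕ → ℤ} (hc : IsSeg i n t c) (P Q : ℤ → Prop)
    (h1 : ∀ x y, P x → Q y → x - y ∉ Sseg i n ∧ y - x ∉ Sseg i n)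
    (h : ∀ q, 1 ≤ q → q ≤ t → P (c q) ∨ Q (c q)) (hP : P (c 1)) :
    ∀ q, 1 ≤ q → q ≤ t → P (c q) := by
  intro q hq
  induction q, hq using Nat.le_induction with
  | base => exact fun _ => hP
  | succ k hk ih =>
    intro hkt
    rcases h (k + 1) (by omega) hkt with h2 | h2
    · exact h2
    · have := hc (k + 1) (by omega) hkt
      exact absurd this (h1 _ _ (ih (by omega)) h2).2

theorem seg_next {i n r : ℕ} {a : ℕ → ℤ} (ha : IsSeg i n r a) (hr : 1 ≤ r) (x : ℤ)
    (h1 : a 1 ≤ x + 2 * ((min i (n + 1 - i) : ℕ) : ℤ)) (h2 : x < a r) :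
    ∃ p, 1 ≤ p ∧ p ≤ r ∧ x < a p ∧ a p ≤ x + 2 * ((min i (n + 1 - i) : ℕ) : ℤ) := by
  classical
  have hex : ∃ p, 1 ≤ p ∧ x < a p := ⟨r, hr, h2⟩
  obtain ⟨hf1, hf2⟩ := Nat.find_spec hex
  have hle : Nat.find hex ≤ r := Nat.find_min' hex ⟨hr, h2⟩
  have hmin := fun k => @Nat.find_min _ _ hex k
  generalize Nat.find hex = p at *
  refine ⟨p, hf1, hle, hf2, ?_⟩
  rcases hf1.eq_or_lt with h | h
  · rw [← h]; exact h1
  · have h3 := hmin (p - 1) (by omega)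
    have h4 := ((mem_Sseg _ _ _).1 (ha p h hle)).2.1
    have h5 : ¬ x < a (p - 1) := fun h6 => h3 ⟨by omega, h6⟩
    omega

theorem seg_of_finset {i n : ℕ} (U : Finset ℤ) (hev : ∀ x ∈ U, ∀ y ∈ U, Even (x - y))
    (hU : ∀ x ∈ U, ∀ z ∈ U, x < z →
      ∃ y ∈ U, x < y ∧ y ≤ x + 2 * ((min i (n + 1 - i) : ℕ) : ℤ)) :
    ∃ c : ℕ → ℤ, IsSeg i n U.card c ∧ ∀ q, 1 ≤ q → q ≤ U.card → c q ∈ U := by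
  let e := U.orderEmbOfFin rfl
  refine ⟨fun q => if h : q - 1 < U.card then e ⟨q - 1, h⟩ else 0, ?_, ?_⟩
  · intro p hp hpU
    have h1 : p - 1 < U.card := by omega
    have h2 : p - 1 - 1 < U.card := by omega
    simp only [h1, h2, dif_pos]
    rw [mem_Sseg]
    have hlt : e ⟨p - 1 - 1, h2⟩ < e ⟨p - 1, h1⟩ := by
      rw [e.lt_iff_lt, Fin.mk_lt_mk]; omega
    have m1 : e ⟨p - 1, h1⟩ ∈ U := Finset.orderEmbOfFin_mem U rfl _
    have m2 : e ⟨p - 1 - 1, h2⟩ ∈ U := Finset.orderEmbOfFin_mem U rfl _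
    refine ⟨by omega, ?_, hev _ m1 _ m2⟩
    obtain ⟨y, hy, hy1, hy2⟩ := hU _ m2 _ m1 hlt
    have : y ∈ Set.range e := by
      rw [Finset.range_orderEmbOfFin]; exact hy
    obtain ⟨j, rfl⟩ := this
    rw [e.lt_iff_lt, Fin.lt_def] at hy1
    have : e ⟨p - 1, h1⟩ ≤ e j := by
      rw [e.le_iff_le, Fin.le_def]
      simp only at hy1 ⊢
      omega
    omega
  · intro q hq hqU
    have h1 : q - 1 < U.card := by omega
    simp only [h1, dif_pos]
    exact Finset.orderEmbOfFin_mem U rfl _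

theorem stmt1 (n i : ℕ) (hn : 1 ≤ n) (hi1 : 1 ≤ i) (hi2 : i ≤ n)
    (r m : ℕ) (hm : 1 ≤ m) (hrm : m ≤ r)
    (a b : ℕ → ℤ) (ha : IsSeg i n r a) (hb : IsSeg i n m b) :
    GenPos i n r a m b ↔
      ((2 * ((min i (n + 1 - i) : ℕ) : ℤ) < b 1 - a r ∨
        2 * ((min i (n + 1 - i) : ℕ) : ℤ) < a 1 - b m ∨
        Odd (b 1 - a 1)) ∨
       (∀ p : ℕ, 1 ≤ p → p ≤ m → ∃ q : ℕ, 1 ≤ q ∧ q ≤ r ∧ a q = b p)) := by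
  constructor
  · intro hg
    by_contra hcon
    push Not at hcon
    obtain ⟨⟨h1, h2, h3⟩, p0, hp1, hp2, hp3⟩ := hcon
    rw [Int.not_odd_iff_even] at h3
    set A := (Finset.Icc 1 r).image a with hA
    set B := (Finset.Icc 1 m).image b with hB
    have memA : ∀ x, x ∈ A ↔ ∃ p, 1 ≤ p ∧ p ≤ r ∧ a p = x := by
      intro x; simp [hA, and_assoc]
    have memB : ∀ x, x ∈ B ↔ ∃ p, 1 ≤ p ∧ p ≤ m ∧ b p = x := by
      intro x; simp [hB, and_assoc]
    have hev1 : ∀ x ∈ A ∪ B, Even (x - a 1) := by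
      intro x hx
      rcases Finset.mem_union.1 hx with hx | hx
      · obtain ⟨p, q1, q2, rfl⟩ := (memA x).1 hx
        exact seg_even ha p q1 q2
      · obtain ⟨p, q1, q2, rfl⟩ := (memB x).1 hx
        simpa using (seg_even hb p q1 q2).add h3
    obtain ⟨c, hc1, hc2⟩ := seg_of_finset (i := i) (n := n) (A ∪ B) (by
      intro x hx y hy
      simpa using (hev1 x hx).sub (hev1 y hy)) (by
      intro x hx z hz hxz
      have hor : (a 1 ≤ x + 2 * ((min i (n + 1 - i) : ℕ) : ℤ) ∧ x < a r) ∨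
          (b 1 ≤ x + 2 * ((min i (n + 1 - i) : ℕ) : ℤ) ∧ x < b m) := by
        have hM0 : 0 ≤ ((min i (n + 1 - i) : ℕ) : ℤ) := Int.natCast_nonneg _
        generalize ((min i (n + 1 - i) : ℕ) : ℤ) = M at *
        have hM : x < a r ∨ x < b m := by
          rcases Finset.mem_union.1 hz with hz | hz
          · obtain ⟨p, q1, q2, rfl⟩ := (memA z).1 hz
            have := seg_le ha p r q1 q2 le_rfl
            left; omega
          · obtain ⟨p, q1, q2, rfl⟩ := (memB z).1 hz
            have := seg_le hb p m q1 q2 le_rfl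
            right; omega
        rcases Finset.mem_union.1 hx with hx | hx
        · obtain ⟨p, q1, q2, rfl⟩ := (memA x).1 hx
          have := seg_le ha p r q1 q2 le_rfl
          have := seg_le ha 1 p le_rfl q1 q2
          omega
        · obtain ⟨p, q1, q2, rfl⟩ := (memB x).1 hx
          have := seg_le hb p m q1 q2 le_rfl
          have := seg_le hb 1 p le_rfl q1 q2
          omega
      rcases hor with ⟨g1, g2⟩ | ⟨g1, g2⟩
      · obtain ⟨p, q1, q2, q3, q4⟩ := seg_next ha (by omega) x g1 g2
        exact ⟨a p, Finset.mem_union_left _ ((memA _).2 ⟨p, q1, q2, rfl⟩), q3, q4⟩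
      · obtain ⟨p, q1, q2, q3, q4⟩ := seg_next hb hm x g1 g2
        exact ⟨b p, Finset.mem_union_right _ ((memB _).2 ⟨p, q1, q2, rfl⟩), q3, q4⟩)
    refine hg ⟨(A ∪ B).card, c, ?_, hc1, ?_⟩
    · have hlt : A.card < (A ∪ B).card := by
        apply Finset.card_lt_card
        refine (Finset.ssubset_iff_of_subset Finset.subset_union_left).2
          ⟨b p0, Finset.mem_union_right _ ((memB _).2 ⟨p0, hp1, hp2, rfl⟩), ?_⟩
        intro hx
        obtain ⟨q, q1, q2, q3⟩ := (memA _).1 hx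
        exact hp3 q q1 q2 q3
      rw [hA, seg_card ha, ← hA] at hlt
      rw [max_eq_left hrm]
      exact hlt
    · intro q q1 q2
      rcases Finset.mem_union.1 (hc2 q q1 q2) with h | h
      · exact Or.inl ((memA _).1 h)
      · exact Or.inr ((memB _).1 h)
  · rintro hcond ⟨t, c, ht, hc, hcm⟩
    rw [max_eq_left hrm] at ht
    rcases hcond with hcond | hcond
    · have key : ∀ x y, (∃ p : ℕ, 1 ≤ p ∧ p ≤ r ∧ a p = x) →
          (∃ p : ℕ, 1 ≤ p ∧ p ≤ m ∧ b p = y) → x - y ∉ Sseg i n ∧ y - x ∉ Sseg i n := by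
        rintro x y ⟨p, p1, p2, rfl⟩ ⟨q, q1, q2, rfl⟩
        have e1 := seg_le ha p r p1 p2 le_rfl
        have e2 := seg_le ha 1 p le_rfl p1 p2
        have e3 := seg_le hb q m q1 q2 le_rfl
        have e4 := seg_le hb 1 q le_rfl q1 q2
        have e5 := seg_even ha p p1 p2
        have e6 := seg_even hb q q1 q2
        rw [mem_Sseg, mem_Sseg]
        have hM0 : 0 ≤ ((min i (n + 1 - i) : ℕ) : ℤ) := Int.natCast_nonneg _
        generalize ((min i (n + 1 - i) : ℕ) : ℤ) = M at *
        rw [Int.odd_iff] at hcond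
        simp only [Int.even_iff] at e5 e6 ⊢
        omega
      rcases hcm 1 le_rfl (by omega) with h1 | h1
      · have := seg_sub hc (seg_split hc _ _ key hcm h1)
        omega
      · have := seg_sub hc (seg_split hc _ _ (fun x y hx hy => (key y x hy hx).symm)
          (fun q q1 q2 => (hcm q q1 q2).symm) h1)
        omega
    · have := seg_sub (r := r) (a := a) hc (by
        intro q q1 q2
        rcases hcm q q1 q2 with h | ⟨p, p1, p2, p3⟩
        · exact h
        · rw [← p3]; exact hcond p p1 p2)
      omega
end

section
/- Let n ≥ 1, i ∈ {1,…,n}, r ≥ 1, and let a = (a₁,…,a_r) ∈ ℤ^r be arbitrary. Then there exist an integer k ≥ 1, (i,n)-segments a₁,…,a_k that are pairwise in general position, and a permutation σ of {1,…,r} such that (a_{σ(1)},…,a_{σ(r)}) equals the concatenation a₁ ∨ a₂ ∨ ⋯ ∨ a_k. -/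
/-- A nonempty list of integers is an `(i,n)`-segment if consecutive differences
lie in `S_{i,n}`. -/
def IsSegL (i n : ℕ) (l : List ℤ) : Prop :=
  l ≠ [] ∧ l.Chain' (fun x y => y - x ∈ Sseg i n)

/-- Two `(i,n)`-segments are in general position: no `(i,n)`-segment of length strictly
greater than the maximum of their lengths has all its entries among their entries. -/
def GenPosL (i n : ℕ) (u v : List ℤ) : Prop :=
  ¬ ∃ c : List ℤ, IsSegL i n c ∧ max u.length v.length < c.length ∧
      ∀ x ∈ c, x ∈ u ∨ x ∈ v

theorem IsSegL.nodup {i n : ℕ} {c : List ℤ} (h : IsSegL i n c) : c.Nodup := by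
  have h1 : c.IsChain (· < ·) := by
    refine List.IsChain.imp ?_ h.2
    rintro x y ⟨j, h1, _, h3⟩
    have : (1 : ℤ) ≤ j := by exact_mod_cast h1
    show x < y
    omega
  exact h1.pairwise.imp (fun hxy => ne_of_lt hxy)

theorem stmt5_aux (n i N : ℕ) : ∀ a : List ℤ, a.length ≤ N →
    ∃ segs : List (List ℤ), (∀ s ∈ segs, IsSegL i n s) ∧
      segs.Pairwise (GenPosL i n) ∧ a.Perm segs.flatten := by
  classical
  induction N with
  | zero =>
    intro a h
    have : a = [] := List.length_eq_zero_iff.mp (by omega)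
    subst this
    exact ⟨[], by simp, by simp, by simp⟩
  | succ N ih =>
    intro a hN
    rcases a with _ | ⟨x, t⟩
    · exact ⟨[], by simp, by simp, by simp⟩
    set a := x :: t with ha
    let P : ℕ → Prop := fun m => ∃ c : List ℤ, IsSegL i n c ∧ c ⊆ a ∧ c.length = m
    have bd : ∀ c, IsSegL i n c → c ⊆ a → c.length ≤ a.length := fun c h1 h2 =>
      (List.subperm_of_subset h1.nodup h2).length_le
    have P1 : P 1 := ⟨[x], ⟨by simp, List.isChain_singleton x⟩, by simp [ha], rfl⟩
    obtain ⟨c, hc, hca, hcl⟩ : P (Nat.findGreatest P a.length) :=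
      Nat.findGreatest_spec (m := 1) (by simp [ha]) P1
    have hmax : ∀ d, IsSegL i n d → d ⊆ a → d.length ≤ c.length := by
      intro d h1 h2
      rw [hcl]
      exact Nat.le_findGreatest (bd d h1 h2) ⟨d, h1, h2, rfl⟩
    have hp : a.Perm (c ++ a.diff c) :=
      (List.subperm_append_diff_self_of_count_le
        (List.subperm_ext_iff.mp (List.subperm_of_subset hc.nodup hca))).symm
    have hpos : 0 < c.length := List.length_pos_iff.mpr hc.1
    have hl := hp.length_eq
    rw [List.length_append] at hl
    obtain ⟨segs, s1, s2, s3⟩ := ih (a.diff c) (by omega)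
    refine ⟨c :: segs, ?_, ?_, ?_⟩
    · intro s hs
      rcases List.mem_cons.mp hs with rfl | hs
      · exact hc
      · exact s1 s hs
    · refine List.pairwise_cons.mpr ⟨?_, s2⟩
      rintro s hs ⟨d, d1, d2, d3⟩
      have := hmax d d1 (by
        intro y hy
        rcases d3 y hy with h | h
        · exact hca h
        · exact hp.mem_iff.mpr (List.mem_append_right _
            (s3.mem_iff.mpr (List.mem_flatten.mpr ⟨s, hs, h⟩))))
      have := le_max_left c.length s.length
      omega
    · rw [List.flatten_cons]
      exact hp.trans (s3.append_left c)

theorem stmt5 (n i : ℕ) (hn : 1 ≤ n) (hi1 : 1 ≤ i) (hi2 : i ≤ n)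
    (a : List ℤ) (ha : a ≠ []) :
    ∃ segs : List (List ℤ), 1 ≤ segs.length ∧
      (∀ s ∈ segs, IsSegL i n s) ∧
      segs.Pairwise (GenPosL i n) ∧
      a.Perm segs.flatten := by
  obtain ⟨segs, h1, h2, h3⟩ := stmt5_aux n i a.length a le_rfl
  refine ⟨segs, ?_, h1, h2, h3⟩
  rcases segs with _ | ⟨s, t⟩
  · exact absurd (List.perm_nil.mp (by simpa using h3)) ha
  · simp
end

section
/- Let n ≥ 1 and i ∈ {1,…,n}. Suppose a₁,…,a_k and c₁,…,c_ℓ are two lists of (i,n)-segments, each list pairwise in general position, and suppose that the concatenations a₁ ∨ ⋯ ∨ a_k and c₁ ∨ ⋯ ∨ c_ℓ are permutations of one another (i.e., they are tuples in ℤ^r that agree after reordering by some permutation of {1,…,r}). Then ℓ = k and there is a permutation τ of {1,…,k} with c_{τ(s)} = a_s for all s ∈ [1,k]. -/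
lemma mem_Sseg_iff (i n : ℕ) (d : ℤ) :
    d ∈ Sseg i n ↔ 0 < d ∧ d ≤ 2 * ((min i (n + 1 - i) : ℕ) : ℤ) ∧ d % 2 = 0 := by
  constructor
  · rintro ⟨j, h1, h2, rfl⟩
    generalize min i (n + 1 - i) = m at *
    omega
  · rintro ⟨h1, h2, h3⟩
    refine ⟨(d / 2).toNat, ?_, ?_, ?_⟩
    all_goals
      generalize min i (n + 1 - i) = m at *
      omega

/-- step relation -/
def RR (M x y : ℤ) : Prop := 0 < y - x ∧ y - x ≤ M ∧ (y - x) % 2 = 0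

def AdjR (M x y : ℤ) : Prop := RR M x y ∨ RR M y x

lemma isSegL_iff (i n : ℕ) (l : List ℤ) :
    IsSegL i n l ↔ l ≠ [] ∧ l.IsChain (RR (2 * ((min i (n + 1 - i) : ℕ) : ℤ))) := by
  unfold IsSegL
  have : (fun x y : ℤ => y - x ∈ Sseg i n) = RR (2 * ((min i (n + 1 - i) : ℕ) : ℤ)) := by
    funext x y
    exact propext (mem_Sseg_iff i n _)
  rw [this]
  exact Iff.rfl

lemma chain_head {M : ℤ} : ∀ (t : List ℤ) (u : ℤ), (u :: t).IsChain (RR M) →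
    ∀ z ∈ u :: t, u ≤ z ∧ (z - u) % 2 = 0 := by
  intro t
  induction t with
  | nil => intro u _ z hz; simp at hz; subst hz; simp
  | cons v t ih =>
    intro u h z hz
    rw [List.isChain_cons_cons] at h
    rcases List.mem_cons.1 hz with rfl | hz
    · simp
    · have := ih v h.2 z hz
      have h1 := h.1
      unfold RR at h1
      omega

lemma chain_insert {M : ℤ} (y : ℤ) : ∀ (t : List ℤ) (u : ℤ), (u :: t).IsChain (RR M) →
    y ∉ u :: t → (∃ z ∈ u :: t, AdjR M y z) →
    (List.orderedInsert (· ≤ ·) y (u :: t)).IsChain (RR M) := by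
  intro t
  induction t with
  | nil =>
    intro u h hy ⟨z, hz, hz2⟩
    simp at hz hy
    subst hz
    unfold AdjR RR at hz2
    by_cases hle : y ≤ z
    · simp [List.orderedInsert, hle, RR]; omega
    · simp [List.orderedInsert, hle, RR]; omega
  | cons v t ih =>
    intro u h hy ⟨z, hz, hz2⟩
    have hh := chain_head _ _ h z hz
    have h0 := h
    rw [List.isChain_cons_cons] at h
    have h1 := h.1
    have hyu : y ≠ u := by rintro rfl; simp at hy
    have hyv : y ≠ v := by rintro rfl; simp at hy
    by_cases hle : y ≤ u
    · rw [List.orderedInsert, if_pos hle, List.isChain_cons_cons]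
      refine ⟨?_, h0⟩
      unfold AdjR at hz2
      unfold RR at *
      omega
    · rw [List.orderedInsert, if_neg hle]
      by_cases hle2 : y ≤ v
      · rw [List.orderedInsert, if_pos hle2, List.isChain_cons_cons, List.isChain_cons_cons]
        unfold AdjR at hz2
        refine ⟨?_, ?_, h.2⟩
        all_goals
          unfold RR at *
          omega
      · have key := ih v h.2 (fun hm => hy (List.mem_cons_of_mem _ hm)) (by
          rcases List.mem_cons.1 hz with rfl | hz
          · refine ⟨v, by simp, ?_⟩
            unfold AdjR at *
            unfold RR at *
            omega
          · exact ⟨z, hz, hz2⟩)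
        rw [List.orderedInsert, if_neg hle2] at key ⊢
        rw [List.isChain_cons_cons]
        exact ⟨h1, key⟩

lemma walk {M : ℤ} (P : ℤ → Prop) : ∀ (l : List ℤ), l.IsChain (RR M) →
    (∃ x ∈ l, P x) → (∀ x, P x → ∀ y ∈ l, AdjR M y x → P y) → ∀ y ∈ l, P y := by
  intro l
  induction l with
  | nil => simp
  | cons u t ih =>
    intro h ⟨x, hx, hPx⟩ hc
    cases t with
    | nil => simp at hx ⊢; exact hx ▸ hPx
    | cons v t =>
      rw [List.isChain_cons_cons] at h
      have hc' : ∀ x, P x → ∀ y ∈ v :: t, AdjR M y x → P y :=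
        fun x hx y hy => hc x hx y (List.mem_cons_of_mem _ hy)
      have hall : ∀ y ∈ v :: t, P y := by
        rcases List.mem_cons.1 hx with rfl | hx
        · exact ih h.2 ⟨v, by simp, hc _ hPx v (by simp) (Or.inr h.1)⟩ hc'
        · exact ih h.2 ⟨x, hx, hPx⟩ hc'
      intro y hy
      rcases List.mem_cons.1 hy with rfl | hy
      · exact hc v (hall v (by simp)) _ (by simp) (Or.inl h.1)
      · exact hall y hy

lemma chain_sorted {M : ℤ} (l : List ℤ) (h : l.IsChain (RR M)) : l.Pairwise (· < ·) := by
  rw [← List.isChain_iff_pairwise]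
  exact h.imp (fun a b hab => by unfold RR at hab; omega)

lemma genPos_symm (i n : ℕ) {u v : List ℤ} (h : GenPosL i n u v) : GenPosL i n v u := by
  rintro ⟨c, h1, h2, h3⟩
  exact h ⟨c, h1, by rwa [max_comm], fun x hx => (h3 x hx).symm⟩

lemma genPos_closed (i n : ℕ) (a b : List ℤ) (h : GenPosL i n a b) (ha : IsSegL i n a)
    (hlen : b.length ≤ a.length) (y : ℤ) (hy : y ∈ b)
    (hadj : ∃ z ∈ a, AdjR (2 * ((min i (n + 1 - i) : ℕ) : ℤ)) y z) : y ∈ a := by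
  by_contra hya
  rw [isSegL_iff] at ha
  apply h
  refine ⟨List.orderedInsert (· ≤ ·) y a, ?_, ?_, ?_⟩
  · rw [isSegL_iff]
    cases a with
    | nil => exact absurd rfl ha.1
    | cons u t =>
      refine ⟨?_, chain_insert y t u ha.2 hya hadj⟩
      intro h0
      have := congrArg List.length h0
      rw [List.orderedInsert_length] at this
      simp at this
  · rw [List.orderedInsert_length, max_eq_left hlen]; omega
  · intro x hx
    rw [List.mem_orderedInsert] at hx
    rcases hx with rfl | hx
    · exact Or.inr hy
    · exact Or.inl hx

lemma closed_list (i n : ℕ) (A : List (List ℤ)) (hpA : A.Pairwise (GenPosL i n))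
    (a b : List ℤ) (haA : a ∈ A) (hbA : b ∈ A) (ha : IsSegL i n a)
    (hlen : b.length ≤ a.length) (y : ℤ) (hy : y ∈ b)
    (hadj : ∃ z ∈ a, AdjR (2 * ((min i (n + 1 - i) : ℕ) : ℤ)) y z) : y ∈ a := by
  by_cases hab : a = b
  · rwa [hab]
  · refine genPos_closed i n a b ?_ ha hlen y hy hadj
    haveI : Std.Symm (GenPosL i n) := ⟨fun _ _ h => genPos_symm i n h⟩
    exact hpA.forall haA hbA hab

lemma exists_longest (L : List (List ℤ)) (P : List ℤ → Prop) (h : ∃ a ∈ L, P a) :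
    ∃ a ∈ L, P a ∧ ∀ b ∈ L, P b → b.length ≤ a.length := by
  classical
  obtain ⟨a, ha, hP⟩ := h
  obtain ⟨c, hc, hmax⟩ := Finset.exists_max_image (L.toFinset.filter P) List.length
    ⟨a, by simp [ha, hP]⟩
  simp at hc hmax
  exact ⟨c, hc.1, hc.2, hmax⟩

lemma key_mem (i n : ℕ) (A C : List (List ℤ))
    (hA : ∀ s ∈ A, IsSegL i n s) (hC : ∀ s ∈ C, IsSegL i n s)
    (hpA : A.Pairwise (GenPosL i n)) (hpC : C.Pairwise (GenPosL i n))
    (hperm : A.flatten.Perm C.flatten) (a : List ℤ) (ha : a ∈ A)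
    (hmA : ∀ s ∈ A, s.length ≤ a.length) : a ∈ C := by
  have hsup : ∀ y, (∃ s ∈ A, y ∈ s) ↔ (∃ s ∈ C, y ∈ s) := by
    intro y
    rw [← List.mem_flatten, ← List.mem_flatten]
    exact hperm.mem_iff
  have hseg := (isSegL_iff i n a).1 (hA a ha)
  -- `a` is closed under adjacency in the support
  have hcl : ∀ x, x ∈ a → ∀ y, (∃ s ∈ C, y ∈ s) →
      AdjR (2 * ((min i (n + 1 - i) : ℕ) : ℤ)) y x → y ∈ a := by
    intro x hx y hy hxy
    obtain ⟨b, hb, hyb⟩ := (hsup y).2 hy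
    exact closed_list i n A hpA a b ha hb (hA a ha) (hmA b hb) y hyb ⟨x, hx, hxy⟩
  have hsub : ∀ c ∈ C, (∃ x ∈ c, x ∈ a) → ∀ y ∈ c, y ∈ a := by
    intro c hc hx
    exact walk (· ∈ a) c ((isSegL_iff i n c).1 (hC c hc)).2 hx
      (fun x hx y hy hxy => hcl x hx y ⟨c, hc, hy⟩ hxy)
  obtain ⟨x, hx⟩ := List.exists_mem_of_ne_nil a hseg.1
  obtain ⟨c0, hc0, hxc0⟩ := (hsup x).1 ⟨a, ha, hx⟩
  obtain ⟨c, hc, hPc, hmax⟩ := exists_longest C (fun c => ∃ x ∈ c, x ∈ a) ⟨c0, hc0, x, hxc0, hx⟩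
  have hca := hsub c hc hPc
  have hac : ∀ y ∈ a, y ∈ c := by
    obtain ⟨x1, h1, h2⟩ := hPc
    refine walk (· ∈ c) a hseg.2 ⟨x1, h2, h1⟩ ?_
    intro z hz y hy hyz
    obtain ⟨b, hb, hyb⟩ := (hsup y).1 ⟨a, ha, hy⟩
    exact closed_list i n C hpC c b hc hb (hC c hc) (hmax b hb ⟨y, hyb, hy⟩) y hyb ⟨z, hz, hyz⟩
  have s1 := chain_sorted a hseg.2
  have s2 := chain_sorted c ((isSegL_iff i n c).1 (hC c hc)).2
  have hp : a.Perm c := by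
    refine (List.perm_ext_iff_of_nodup (s1.imp ne_of_lt) (s2.imp ne_of_lt)).2 ?_
    exact fun y => ⟨hac y, hca y⟩
  have : a = c := hp.eq_of_pairwise (fun _ _ _ _ h1 h2 => absurd h1 (not_lt.2 h2.le)) s1 s2
  rwa [this]

theorem stmt6 (n i : ℕ) (hn : 1 ≤ n) (hi1 : 1 ≤ i) (hi2 : i ≤ n)
    (A C : List (List ℤ))
    (hA : ∀ s ∈ A, IsSegL i n s) (hC : ∀ s ∈ C, IsSegL i n s)
    (hpA : A.Pairwise (GenPosL i n)) (hpC : C.Pairwise (GenPosL i n))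
    (hperm : A.flatten.Perm C.flatten) :
    A.Perm C := by
  induction hN : A.length generalizing A C with
  | zero =>
    have : A = [] := List.length_eq_zero_iff.1 hN
    subst this
    cases C with
    | nil => exact List.Perm.refl _
    | cons c C =>
      exfalso
      simp at hperm
      exact (hC c (by simp)).1 hperm.1
  | succ N ih =>
    have hne : ∃ a ∈ A, True := by
      cases A with
      | nil => simp at hN
      | cons a A => exact ⟨a, by simp, trivial⟩
    obtain ⟨a, ha, -, hmax⟩ := exists_longest A (fun _ => True) hne
    have haC := key_mem i n A C hA hC hpA hpC hperm a ha (fun s hs => hmax s hs trivial)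
    have p1 := List.perm_cons_erase ha
    have p2 := List.perm_cons_erase haC
    have hfl : (A.erase a).flatten.Perm (C.erase a).flatten := by
      have := (p1.flatten.symm.trans hperm).trans p2.flatten
      rw [List.flatten_cons, List.flatten_cons] at this
      exact (List.perm_append_left_iff a).1 this
    have := ih (A.erase a) (C.erase a) (fun s hs => hA s (List.mem_of_mem_erase hs))
      (fun s hs => hC s (List.mem_of_mem_erase hs))
      (hpA.sublist List.erase_sublist) (hpC.sublist List.erase_sublist)
      hfl (by rw [List.length_erase_of_mem ha]; omega)
    exact p1.trans ((this.cons a).trans p2.symm)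
end

section
/- Fix n ≥ 1, j ∈ {1,…,n} and a ∈ ℤ. The set of paths p ∈ 𝙿^{(n)}_{j,a} with C_p⁻ = {j} has exactly min(j, n+1−j) elements, and the set of their weights satisfies {ω(p) : p ∈ 𝙿^{(n)}_{j,a}, C_p⁻ = {j}} = {ω_{j−m,a+m} · ω_{j,a+2m}^{−1} · ω_{j+m,a+m} : 1 ≤ m ≤ min(j, n+1−j)} (with the conventions ω_{0,c} = ω_{n+1,c} = 1). -/
/-- Generator `ω_{j,c}` of `P_N` (written additively as `(ℤ × ℤ) →₀ ℤ`),
with the convention that `ω_{j,c} = 1` (i.e. `0`) for `j ∉ [1,N]`. -/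
noncomputable def og (N : ℕ) (j c : ℤ) : (ℤ × ℤ) →₀ ℤ :=
  if 1 ≤ j ∧ j ≤ (N : ℤ) then Finsupp.single (j, c) 1 else 0

/-- Value of a path `p : Fin (n+2) → ℤ` at a natural number index. -/
def pv (n : ℕ) (p : Fin (n + 2) → ℤ) (t : ℕ) : ℤ :=
  if h : t < n + 2 then p ⟨t, h⟩ else 0

/-- `p ∈ 𝙿^{(n)}_{i,a}`, on domain `{0,…,n+1}`. -/
def IsPathF (n i : ℕ) (a : ℤ) (p : Fin (n + 2) → ℤ) : Prop :=
  pv n p 0 = (i : ℤ) + a ∧ pv n p (n + 1) = (n : ℤ) + 1 - i + a ∧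
    ∀ r : ℕ, r ≤ n → (pv n p (r + 1) - pv n p r = 1 ∨ pv n p (r + 1) - pv n p r = -1)

/-- `C_p⁻ = {r ∈ [1,n] : p(r-1) = p(r) - 1 = p(r+1)}`. -/
def CminusF (n : ℕ) (p : Fin (n + 2) → ℤ) : Set ℕ :=
  {r | 1 ≤ r ∧ r ≤ n ∧ pv n p (r - 1) = pv n p r - 1 ∧ pv n p (r + 1) = pv n p r - 1}

/-- The weight `ω(p) = ∏_{r ∈ C_p⁺} ω_{r,p(r)} ∏_{r ∈ C_p⁻} ω_{r,p(r)}⁻¹`, additively. -/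
noncomputable def wtF (n : ℕ) (p : Fin (n + 2) → ℤ) : (ℤ × ℤ) →₀ ℤ :=
  (∑ r ∈ Finset.Icc 1 n,
      if pv n p (r - 1) = pv n p r + 1 ∧ pv n p (r + 1) = pv n p r + 1 then
        Finsupp.single ((r : ℤ), pv n p r) 1 else 0)
  - ∑ r ∈ Finset.Icc 1 n,
      if pv n p (r - 1) = pv n p r - 1 ∧ pv n p (r + 1) = pv n p r - 1 then
        Finsupp.single ((r : ℤ), pv n p r) 1 else 0


def Qf (j : ℕ) (a : ℤ) (m r : ℕ) : ℤ :=
  if r ≤ j then max (j + a - r) (a + 2 * m - j + r) else max (a + 2 * m - r + j) (a - j + r)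

def Qp (n j : ℕ) (a : ℤ) (m : ℕ) : Fin (n + 2) → ℤ := fun i => Qf j a m i

lemma pv_Qp (n j : ℕ) (a : ℤ) (m t : ℕ) (h : t < n + 2) :
    pv n (Qp n j a m) t = Qf j a m t := by
  simp [pv, Qp, h]

lemma vshape (f : ℕ → ℤ) (L : ℕ) (hs : ∀ r, r < L → f (r+1) - f r = 1 ∨ f (r+1) - f r = -1)
    (hm : ∀ r, r + 1 < L → ¬ (f r = f (r+1) - 1 ∧ f (r+2) = f (r+1) - 1)) :
    ∃ c ≤ L, ∀ r ≤ L, (r ≤ c → f r = f 0 - r) ∧ (c ≤ r → f r = f 0 - 2 * c + r) := by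
  induction L with
  | zero =>
    refine ⟨0, le_rfl, ?_⟩
    intro r hr
    obtain rfl : r = 0 := by omega
    simp
  | succ L ih =>
    obtain ⟨c, hc, h⟩ := ih (fun r hr => hs r (by omega)) (fun r hr => hm r (by omega))
    have hL := h L le_rfl
    rcases hs L (by omega) with h1 | h1
    · refine ⟨c, by omega, fun r hr => ?_⟩
      rcases Nat.lt_or_ge L r with h2 | h2
      · obtain rfl : r = L + 1 := by omega
        have := hL.2 hc
        push_cast
        constructor
        · intro; omega
        · intro; omega
      · exact h r h2
    · rcases Nat.lt_or_ge c L with h2 | h2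
      · exfalso
        obtain ⟨k, rfl⟩ : ∃ k, L = k + 1 := ⟨L - 1, by omega⟩
        have e1 := (h k (by omega)).2 (by omega)
        have e2 := hL.2 hc
        push_cast at e2
        have h3 : f (k + 2) - f (k+1) = -1 := h1
        exact hm k (by omega) ⟨by omega, by omega⟩
      · obtain rfl : c = L := by omega
        have := hL.1 le_rfl
        refine ⟨c + 1, le_rfl, fun r hr => ?_⟩
        rcases Nat.lt_or_ge c r with h2 | h2
        · obtain rfl : r = c + 1 := by omega
          push_cast
          constructor
          · intro; omega
          · intro; omega
        · exact ⟨fun _ => (h r h2).1 h2, fun _ => by omega⟩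

lemma Q_good (n j : ℕ) (hj1 : 1 ≤ j) (hj2 : j ≤ n) (a : ℤ) (m : ℕ) (h1 : 1 ≤ m)
    (h2 : m ≤ min j (n + 1 - j)) :
    IsPathF n j a (Qp n j a m) ∧ CminusF n (Qp n j a m) = {j} := by
  have hA : m ≤ j := by omega
  have hB : j + m ≤ n + 1 := by omega
  refine ⟨⟨?_, ?_, ?_⟩, ?_⟩
  · rw [pv_Qp _ _ _ _ _ (by omega)]
    unfold Qf; split_ifs <;> push_cast <;> omega
  · rw [pv_Qp _ _ _ _ _ (by omega)]
    unfold Qf; split_ifs <;> push_cast <;> omega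
  · intro r hr
    rw [pv_Qp _ _ _ _ _ (by omega), pv_Qp _ _ _ _ _ (by omega)]
    unfold Qf; split_ifs <;> push_cast <;> omega
  · ext r
    simp only [CminusF, Set.mem_setOf_eq, Set.mem_singleton_iff]
    constructor
    · rintro ⟨h3, h4, h5, h6⟩
      rw [pv_Qp _ _ _ _ _ (by omega), pv_Qp _ _ _ _ _ (by omega)] at h5 h6
      unfold Qf at h5 h6
      push_cast [h3] at h5 h6
      split_ifs at h5 h6 <;> omega
    · rintro rfl
      refine ⟨hj1, hj2, ?_, ?_⟩
      · rw [pv_Qp _ _ _ _ _ (by omega), pv_Qp _ _ _ _ _ (by omega)]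
        unfold Qf; push_cast [hj1]; split_ifs <;> omega
      · rw [pv_Qp _ _ _ _ _ (by omega), pv_Qp _ _ _ _ _ (by omega)]
        unfold Qf; push_cast; split_ifs <;> omega

lemma good_Q (n j : ℕ) (hj1 : 1 ≤ j) (hj2 : j ≤ n) (a : ℤ) (p : Fin (n + 2) → ℤ)
    (hp : IsPathF n j a p) (hC : CminusF n p = {j}) :
    ∃ m, (1 ≤ m ∧ m ≤ min j (n + 1 - j)) ∧ Qp n j a m = p := by
  obtain ⟨p0, p1, hs⟩ := hp
  have hno : ∀ r, r + 1 ≤ n → r + 1 ≠ j →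
      ¬ (pv n p r = pv n p (r+1) - 1 ∧ pv n p (r+2) = pv n p (r+1) - 1) := by
    rintro r hr hne ⟨e1, e2⟩
    have : r + 1 ∈ CminusF n p := ⟨by omega, hr, e1, e2⟩
    rw [hC] at this
    exact hne this
  have hjm : j ∈ CminusF n p := by rw [hC]; rfl
  obtain ⟨-, -, hj3, hj4⟩ := hjm
  obtain ⟨c, hc, H⟩ := vshape (pv n p) j (fun r hr => hs r (by omega))
    (fun r hr => hno r (by omega) (by omega))
  obtain ⟨d, hd, K⟩ := vshape (fun r => pv n p (j + r)) (n + 1 - j)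
    (fun r hr => hs (j + r) (by omega))
    (fun r hr => hno (j + r) (by omega) (by omega))
  simp only [add_zero] at K
  have a1 := (H j le_rfl).2 hc
  have a2 := H (j-1) (by omega)
  have a3 := (K (n+1-j) le_rfl).2 hd
  rw [show j + (n + 1 - j) = n + 1 by omega] at a3
  have hcd : c + d = j := by omega
  have hcj : c < j := by
    by_contra hcon
    have := a2.1 (by omega)
    have := (H j le_rfl).1 (by omega)
    omega
  refine ⟨d, by omega, ?_⟩
  funext i
  have hi : pv n p i = p i := by simp [pv]
  rw [← hi]
  have hi2 := i.2
  unfold Qp Qf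
  generalize (i : ℕ) = r at hi2
  split_ifs with h
  · have := H r h
    rcases le_total r c with h5 | h5
    · have := this.1 h5; omega
    · have := this.2 h5; omega
  · have := K (r - j) (by omega)
    rw [show j + (r - j) = r by omega] at this
    rcases le_total (r - j) d with h5 | h5
    · have := this.1 h5; omega
    · have := this.2 h5; omega

lemma wt_Q (n j : ℕ) (hj1 : 1 ≤ j) (hj2 : j ≤ n) (a : ℤ) (m : ℕ) (h1 : 1 ≤ m)
    (h2 : m ≤ min j (n + 1 - j)) :
    wtF n (Qp n j a m) =
      og n ((j : ℤ) - m) (a + m) - og n j (a + 2 * m) + og n ((j : ℤ) + m) (a + m) := by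
  have hA : m ≤ j := by omega
  have hB : j + m ≤ n + 1 := by omega
  have S1 : (∑ r ∈ Finset.Icc 1 n,
      if pv n (Qp n j a m) (r - 1) = pv n (Qp n j a m) r + 1 ∧
        pv n (Qp n j a m) (r + 1) = pv n (Qp n j a m) r + 1 then
        Finsupp.single ((r : ℤ), pv n (Qp n j a m) r) (1:ℤ) else 0) =
      ∑ r ∈ Finset.Icc 1 n, ((if r = j - m then Finsupp.single ((j:ℤ) - m, a + m) (1:ℤ) else 0)
        + (if r = j + m then Finsupp.single ((j:ℤ) + m, a + m) (1:ℤ) else 0)) := by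
    refine Finset.sum_congr rfl fun r hr => ?_
    rw [Finset.mem_Icc] at hr
    rw [pv_Qp _ _ _ _ _ (by omega), pv_Qp _ _ _ _ _ (by omega), pv_Qp _ _ _ _ _ (by omega)]
    by_cases e1 : r = j - m
    · have e2 : r ≠ j + m := by omega
      have v : Qf j a m r = a + m := by unfold Qf; split_ifs <;> omega
      rw [if_pos e1, if_neg e2, add_zero, if_pos, v, show (r:ℤ) = j - m by omega]
      rw [v]
      unfold Qf; push_cast [hr.1]; constructor <;> split_ifs <;> omega
    · rw [if_neg e1, zero_add]
      by_cases e2 : r = j + m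
      · have v : Qf j a m r = a + m := by unfold Qf; split_ifs <;> omega
        rw [if_pos e2, if_pos, v, show (r:ℤ) = j + m by omega]
        rw [v]
        unfold Qf; push_cast [hr.1]; constructor <;> split_ifs <;> omega
      · rw [if_neg e2, if_neg]
        unfold Qf; push_cast [hr.1]; rintro ⟨h5, h6⟩
        split_ifs at h5 h6 <;> omega
  have S2 : (∑ r ∈ Finset.Icc 1 n,
      if pv n (Qp n j a m) (r - 1) = pv n (Qp n j a m) r - 1 ∧
        pv n (Qp n j a m) (r + 1) = pv n (Qp n j a m) r - 1 then
        Finsupp.single ((r : ℤ), pv n (Qp n j a m) r) (1:ℤ) else 0) =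
      ∑ r ∈ Finset.Icc 1 n, (if r = j then Finsupp.single ((j:ℤ), a + 2 * m) (1:ℤ) else 0) := by
    refine Finset.sum_congr rfl fun r hr => ?_
    rw [Finset.mem_Icc] at hr
    have hC := (Q_good n j hj1 hj2 a m h1 h2).2
    have hiff : (pv n (Qp n j a m) (r - 1) = pv n (Qp n j a m) r - 1 ∧
        pv n (Qp n j a m) (r + 1) = pv n (Qp n j a m) r - 1) ↔ r = j := by
      rw [← Set.mem_singleton_iff (a := r) (b := j), ← hC]
      exact ⟨fun h => ⟨hr.1, hr.2, h⟩, fun h => h.2.2⟩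
    by_cases e : r = j
    · rw [if_pos (hiff.2 e), if_pos e, pv_Qp _ _ _ _ _ (by omega)]
      have v : Qf j a m r = a + 2 * m := by unfold Qf; split_ifs <;> omega
      rw [v, e]
    · rw [if_neg (fun h => e (hiff.1 h)), if_neg e]
  unfold wtF
  rw [S1, S2, Finset.sum_add_distrib, Finset.sum_ite_eq', Finset.sum_ite_eq', Finset.sum_ite_eq']
  simp only [og, Finset.mem_Icc]
  have i1 : (1 ≤ (j:ℤ) - m ∧ (j:ℤ) - m ≤ n) ↔ (1 ≤ j - m ∧ j - m ≤ n) := by omega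
  have i2 : (1 ≤ (j:ℤ) + m ∧ (j:ℤ) + m ≤ n) ↔ (1 ≤ j + m ∧ j + m ≤ n) := by omega
  have i3 : (1 ≤ (j:ℤ) ∧ (j:ℤ) ≤ n) ↔ (1 ≤ j ∧ j ≤ n) := by omega
  simp only [i1, i2, i3]
  abel

theorem stmt8 (n j : ℕ) (hn : 1 ≤ n) (hj1 : 1 ≤ j) (hj2 : j ≤ n) (a : ℤ) :
    {p : Fin (n + 2) → ℤ | IsPathF n j a p ∧ CminusF n p = {j}}.ncard
        = min j (n + 1 - j) ∧
    {w : (ℤ × ℤ) →₀ ℤ | ∃ p : Fin (n + 2) → ℤ,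
        IsPathF n j a p ∧ CminusF n p = {j} ∧ w = wtF n p} =
      {w : (ℤ × ℤ) →₀ ℤ | ∃ m : ℕ, 1 ≤ m ∧ m ≤ min j (n + 1 - j) ∧
        w = og n ((j : ℤ) - m) (a + m) - og n j (a + 2 * m) + og n ((j : ℤ) + m) (a + m)} := by
  constructor
  · have hset : {p : Fin (n + 2) → ℤ | IsPathF n j a p ∧ CminusF n p = {j}} =
        (Qp n j a) '' (Finset.Icc 1 (min j (n + 1 - j)) : Finset ℕ) := by
      ext p
      simp only [Set.mem_setOf_eq, Set.mem_image, Finset.mem_coe, Finset.mem_Icc]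
      constructor
      · rintro ⟨h1, h2⟩
        exact good_Q n j hj1 hj2 a p h1 h2
      · rintro ⟨m, hm, rfl⟩
        exact Q_good n j hj1 hj2 a m hm.1 hm.2
    rw [hset, Set.ncard_image_of_injective, Set.ncard_coe_finset]
    · simp
    · intro x y hxy
      have h := congrFun hxy ⟨j, by omega⟩
      simp only [Qp, Qf, le_refl, if_true] at h
      omega
  · ext w
    simp only [Set.mem_setOf_eq]
    constructor
    · rintro ⟨p, h1, h2, rfl⟩
      obtain ⟨m, hm, rfl⟩ := good_Q n j hj1 hj2 a p h1 h2
      exact ⟨m, hm.1, hm.2, wt_Q n j hj1 hj2 a m hm.1 hm.2⟩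
    · rintro ⟨m, hm1, hm2, rfl⟩
      have := Q_good n j hj1 hj2 a m hm1 hm2
      exact ⟨_, this.1, this.2, (wt_Q n j hj1 hj2 a m hm1 hm2).symm⟩
end

section
/- Fix n ≥ 1, j ∈ {1,…,n} and a ∈ ℤ. The set of paths g ∈ 𝙿^{(n)}_{j,a} with C_g⁻ = {n+1−j} has exactly min(j, n+1−j) elements, and the set of their weights {ω(g) : g ∈ 𝙿^{(n)}_{j,a}, C_g⁻ = {n+1−j}} equals: if 2j > n+1, {ω_{n+1−j−m, a−n−1+2j+m} · ω_{n+1−j, a−n−1+2j+2m}^{−1} · ω_{j+m, a+m} : 1 ≤ m ≤ n+1−j}; and if 2j ≤ n+1, {ω_{j−m, a+m} · ω_{n+1−j, a+n+1−2j+2m}^{−1} · ω_{n+1−j+m, a+n+1−2j+m} : 1 ≤ m ≤ j} (with the conventions ω_{0,c} = ω_{n+1,c} = 1). -/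
theorem seg (q : ℕ → ℤ) (s d : ℕ)
    (hs : ∀ r, s ≤ r → r < s + d → (q (r+1) - q r = 1 ∨ q (r+1) - q r = -1))
    (hp : ∀ r, s ≤ r → r + 1 < s + d → ¬ (q r = q (r+1) - 1 ∧ q (r+2) = q (r+1) - 1)) :
    ∃ x, s ≤ x ∧ x ≤ s + d ∧ (∀ r, s ≤ r → r ≤ x → q r = q s - ((r:ℤ) - s)) ∧
      (∀ r, x ≤ r → r ≤ s + d → q r = q x + ((r:ℤ) - x)) := by
  induction d with
  | zero =>
    refine ⟨s, le_rfl, by omega, ?_, ?_⟩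
    · intro r h1 h2
      obtain rfl : r = s := by omega
      omega
    · intro r h1 h2
      obtain rfl : r = s := by omega
      omega
  | succ d ih =>
    obtain ⟨x, h1, h2, h3, h4⟩ := ih (fun r a b => hs r a (by omega)) (fun r a b => hp r a (by omega))
    rcases hs (s + d) (by omega) (by omega) with h | h
    · refine ⟨x, h1, by omega, h3, ?_⟩
      intro r a b
      by_cases hr : r = s + d + 1
      · subst hr
        have := h4 (s+d) h2 le_rfl
        push_cast at *
        omega
      · exact h4 r a (by omega)
    · have hx : x = s + d := by
        by_contra hne
        have hd : ∃ e, s + d = e + 1 := ⟨s + d - 1, by omega⟩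
        obtain ⟨e, he⟩ := hd
        have a1 := h4 (s+d) h2 le_rfl
        have a2 := h4 e (by omega) (by omega)
        have a3 := hp e (by omega) (by omega)
        rw [he] at a1 h
        apply a3
        push_cast at *
        constructor
        · omega
        · have : e + 1 + 1 = e + 2 := rfl
          rw [this] at h
          omega
      refine ⟨s + d + 1, by omega, by omega, ?_, ?_⟩
      · intro r a b
        by_cases hr : r = s + d + 1
        · subst hr
          have := h3 (s+d) (by omega) (by omega)
          push_cast at *
          omega
        · exact h3 r a (by omega)
      · intro r a b
        obtain rfl : r = s + d + 1 := by omega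
        push_cast
        omega

/-- the explicit path -/
def FF (n j : ℕ) (a : ℤ) (x : ℕ) (t : ℕ) : ℤ :=
  if t ≤ x then (j:ℤ) + a - t
  else if t ≤ n + 1 - j then (j:ℤ) + a - 2 * x + t
  else if t ≤ n + 1 - x then (j:ℤ) + a - 2 * x + 2 * (n + 1 - j) - t
  else a - j + t

def GG (n j : ℕ) (a : ℤ) (x : ℕ) : Fin (n + 2) → ℤ := fun t => FF n j a x t

theorem pvGG (n j : ℕ) (a : ℤ) (x t : ℕ) (ht : t ≤ n + 1) :
    pv n (GG n j a x) t = FF n j a x t := by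
  have : t < n + 2 := by omega
  simp [pv, GG, this]

theorem GGpath (n j : ℕ) (hj1 : 1 ≤ j) (hj2 : j ≤ n) (a : ℤ) (x : ℕ) (hx : x < j)
    (hx' : x < n + 1 - j) : IsPathF n j a (GG n j a x) := by
  refine ⟨?_, ?_, ?_⟩
  · rw [pvGG _ _ _ _ _ (by omega)]; simp [FF]
  · rw [pvGG _ _ _ _ _ (by omega)]; unfold FF; split_ifs <;> push_cast <;> omega
  · intro r hr
    rw [pvGG _ _ _ _ _ (by omega), pvGG _ _ _ _ _ (by omega)]
    unfold FF; split_ifs <;> push_cast <;> omega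

theorem peakGG (n j : ℕ) (hj1 : 1 ≤ j) (hj2 : j ≤ n) (a : ℤ) (x : ℕ) (hx : x < j)
    (hx' : x < n + 1 - j) (r : ℕ) (h1 : 1 ≤ r) (h2 : r ≤ n) :
    (pv n (GG n j a x) (r - 1) = pv n (GG n j a x) r - 1 ∧
      pv n (GG n j a x) (r + 1) = pv n (GG n j a x) r - 1) ↔ r = n + 1 - j := by
  rw [pvGG _ _ _ _ _ (by omega), pvGG _ _ _ _ _ (by omega), pvGG _ _ _ _ _ (by omega)]
  unfold FF; split_ifs <;> push_cast <;> omega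

theorem valGG (n j : ℕ) (hj1 : 1 ≤ j) (hj2 : j ≤ n) (a : ℤ) (x : ℕ) (hx : x < j)
    (hx' : x < n + 1 - j) (r : ℕ) (h1 : 1 ≤ r) (h2 : r ≤ n) :
    (pv n (GG n j a x) (r - 1) = pv n (GG n j a x) r + 1 ∧
      pv n (GG n j a x) (r + 1) = pv n (GG n j a x) r + 1) ↔ (r = x ∨ r = n + 1 - x) := by
  rw [pvGG _ _ _ _ _ (by omega), pvGG _ _ _ _ _ (by omega), pvGG _ _ _ _ _ (by omega)]
  unfold FF; split_ifs <;> push_cast <;> omega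

theorem char (n j : ℕ) (hj1 : 1 ≤ j) (hj2 : j ≤ n) (a : ℤ) (p : Fin (n + 2) → ℤ) :
    (IsPathF n j a p ∧ CminusF n p = {n + 1 - j}) ↔
      ∃ x, x < j ∧ x < n + 1 - j ∧ p = GG n j a x := by
  constructor
  · rintro ⟨⟨h0, hN, hst⟩, hC⟩
    have hC' : ∀ r, (1 ≤ r ∧ r ≤ n ∧ pv n p (r - 1) = pv n p r - 1 ∧
        pv n p (r + 1) = pv n p r - 1) ↔ r = n + 1 - j := by
      intro r
      have : r ∈ CminusF n p ↔ r ∈ ({n + 1 - j} : Set ℕ) := by rw [hC]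
      simpa [CminusF] using this
    obtain ⟨-, -, hk1, hk2⟩ := (hC' (n + 1 - j)).2 rfl
    have hnp : ∀ r, r + 1 ≤ n → r + 1 ≠ n + 1 - j →
        ¬ (pv n p r = pv n p (r+1) - 1 ∧ pv n p (r+2) = pv n p (r+1) - 1) := by
      intro r hr hne hh
      exact hne ((hC' (r+1)).1 ⟨by omega, hr, hh.1, hh.2⟩)
    obtain ⟨k, hk⟩ : ∃ k, k = n + 1 - j := ⟨_, rfl⟩
    rw [← hk] at hk1 hk2
    obtain ⟨x, x1, x2, x3, x4⟩ := seg (pv n p) 0 k (fun r _ _ => hst r (by omega))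
      (fun r _ _ => hnp r (by omega) (by omega))
    obtain ⟨z, z1, z2, z3, z4⟩ := seg (pv n p) k j (fun r _ _ => hst r (by omega))
      (fun r _ _ => hnp r (by omega) (by omega))
    have hxk : x < k := by
      by_contra hh
      have e1 := x3 k (by omega) (by omega)
      have e2 := x3 (k-1) (by omega) (by omega)
      omega
    have hzk : k < z := by
      by_contra hh
      have e1 := z4 (k+1) (by omega) (by omega)
      have : z = k := by omega
      subst this
      push_cast at e1
      omega
    have e1 := x3 x (by omega) le_rfl
    have e2 := x4 k (by omega) (by omega)
    have e3 := z3 z (by omega) le_rfl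
    have e4 := z4 (n+1) (by omega) (by omega)
    have hz : z = n + 1 - x := by push_cast at *; omega
    refine ⟨x, by omega, by omega, ?_⟩
    funext t
    obtain ⟨t, ht⟩ := t
    have hpt : p ⟨t, ht⟩ = pv n p t := by simp [pv, ht]
    rw [hpt]
    show _ = FF n j a x t
    unfold FF
    split_ifs with c1 c2 c3
    · have := x3 t (by omega) c1
      push_cast at *; omega
    · have := x4 t (by omega) (by omega)
      push_cast at *; omega
    · have := z3 t (by omega) (by omega)
      push_cast at *; omega
    · have := z4 t (by omega) (by omega)
      push_cast at *; omega
  · rintro ⟨x, hx, hx', rfl⟩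
    refine ⟨GGpath n j hj1 hj2 a x hx hx', ?_⟩
    ext r
    simp only [CminusF, Set.mem_setOf_eq, Set.mem_singleton_iff]
    constructor
    · rintro ⟨h1, h2, h⟩
      exact (peakGG n j hj1 hj2 a x hx hx' r h1 h2).1 h
    · intro h
      have h1 : 1 ≤ r := by omega
      have h2 : r ≤ n := by omega
      exact ⟨h1, h2, (peakGG n j hj1 hj2 a x hx hx' r h1 h2).2 h⟩

theorem wtGG (n j : ℕ) (hj1 : 1 ≤ j) (hj2 : j ≤ n) (a : ℤ) (x : ℕ) (hx : x < j)
    (hx' : x < n + 1 - j) :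
    wtF n (GG n j a x) = og n x (a + j - x) - og n ((n:ℤ) + 1 - j) (a + n + 1 - 2 * x)
      + og n ((n:ℤ) + 1 - x) (a + n + 1 - j - x) := by
  have hA : ∀ r ∈ Finset.Icc 1 n,
      (if pv n (GG n j a x) (r - 1) = pv n (GG n j a x) r + 1 ∧
          pv n (GG n j a x) (r + 1) = pv n (GG n j a x) r + 1 then
        Finsupp.single ((r : ℤ), pv n (GG n j a x) r) (1:ℤ) else 0) =
      (if r = x then Finsupp.single ((x : ℤ), a + j - x) 1 else 0) +
      (if r = n + 1 - x then Finsupp.single ((n:ℤ) + 1 - x, a + n + 1 - j - x) 1 else 0) := by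
    intro r hr
    rw [Finset.mem_Icc] at hr
    simp only [valGG n j hj1 hj2 a x hx hx' r hr.1 hr.2]
    rw [pvGG _ _ _ _ _ (by omega)]
    by_cases c1 : r = x
    · have c2 : r ≠ n + 1 - x := by omega
      rw [if_pos (Or.inl c1), if_pos c1, if_neg c2, add_zero]
      congr 2
      · omega
      · unfold FF; split_ifs <;> omega
    · by_cases c2 : r = n + 1 - x
      · rw [if_pos (Or.inr c2), if_neg c1, if_pos c2, zero_add]
        congr 2
        · omega
        · unfold FF; split_ifs <;> omega
      · rw [if_neg (by tauto), if_neg c1, if_neg c2, add_zero]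
  have hB : ∀ r ∈ Finset.Icc 1 n,
      (if pv n (GG n j a x) (r - 1) = pv n (GG n j a x) r - 1 ∧
          pv n (GG n j a x) (r + 1) = pv n (GG n j a x) r - 1 then
        Finsupp.single ((r : ℤ), pv n (GG n j a x) r) (1:ℤ) else 0) =
      (if r = n + 1 - j then Finsupp.single ((n:ℤ) + 1 - j, a + n + 1 - 2 * x) 1 else 0) := by
    intro r hr
    rw [Finset.mem_Icc] at hr
    simp only [peakGG n j hj1 hj2 a x hx hx' r hr.1 hr.2]
    rw [pvGG _ _ _ _ _ (by omega)]
    by_cases c1 : r = n + 1 - j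
    · rw [if_pos c1, if_pos c1]
      congr 2
      · omega
      · unfold FF; split_ifs <;> omega
    · rw [if_neg c1, if_neg c1]
  unfold wtF
  rw [Finset.sum_congr rfl hA, Finset.sum_congr rfl hB, Finset.sum_add_distrib,
    Finset.sum_ite_eq', Finset.sum_ite_eq', Finset.sum_ite_eq']
  unfold og
  simp only [Finset.mem_Icc]
  have i1 : (1 ≤ x ∧ x ≤ n) ↔ (1 ≤ (x:ℤ) ∧ (x:ℤ) ≤ n) := by omega
  have i2 : (1 ≤ n + 1 - x ∧ n + 1 - x ≤ n) ↔
    (1 ≤ (n:ℤ) + 1 - x ∧ (n:ℤ) + 1 - x ≤ n) := by omega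
  have i3 : (1 ≤ n + 1 - j ∧ n + 1 - j ≤ n) ↔
    (1 ≤ (n:ℤ) + 1 - j ∧ (n:ℤ) + 1 - j ≤ n) := by omega
  simp only [i1, i2, i3]
  abel

theorem stmt9 (n j : ℕ) (hn : 1 ≤ n) (hj1 : 1 ≤ j) (hj2 : j ≤ n) (a : ℤ) :
    {p : Fin (n + 2) → ℤ | IsPathF n j a p ∧ CminusF n p = {n + 1 - j}}.ncard
        = min j (n + 1 - j) ∧
    (n + 1 < 2 * j →
      {w : (ℤ × ℤ) →₀ ℤ | ∃ p : Fin (n + 2) → ℤ,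
          IsPathF n j a p ∧ CminusF n p = {n + 1 - j} ∧ w = wtF n p} =
        {w : (ℤ × ℤ) →₀ ℤ | ∃ m : ℕ, 1 ≤ m ∧ m ≤ n + 1 - j ∧
          w = og n ((n : ℤ) + 1 - j - m) (a - (n : ℤ) - 1 + 2 * j + m)
              - og n ((n : ℤ) + 1 - j) (a - (n : ℤ) - 1 + 2 * j + 2 * m)
              + og n ((j : ℤ) + m) (a + m)}) ∧
    (2 * j ≤ n + 1 →
      {w : (ℤ × ℤ) →₀ ℤ | ∃ p : Fin (n + 2) → ℤ,
          IsPathF n j a p ∧ CminusF n p = {n + 1 - j} ∧ w = wtF n p} =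
        {w : (ℤ × ℤ) →₀ ℤ | ∃ m : ℕ, 1 ≤ m ∧ m ≤ j ∧
          w = og n ((j : ℤ) - m) (a + m)
              - og n ((n : ℤ) + 1 - j) (a + (n : ℤ) + 1 - 2 * j + 2 * m)
              + og n ((n : ℤ) + 1 - j + m) (a + (n : ℤ) + 1 - 2 * j + m)}) := by
  refine ⟨?_, ?_, ?_⟩
  · have hS : {p : Fin (n + 2) → ℤ | IsPathF n j a p ∧ CminusF n p = {n + 1 - j}} =
        (GG n j a) '' (Finset.range (min j (n + 1 - j)) : Set ℕ) := by
      ext p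
      rw [Set.mem_setOf_eq, char n j hj1 hj2 a p]
      simp only [Set.mem_image, Finset.coe_range, Set.mem_Iio, lt_min_iff]
      constructor
      · rintro ⟨x, h1, h2, h3⟩
        exact ⟨x, ⟨h1, h2⟩, h3.symm⟩
      · rintro ⟨x, ⟨h1, h2⟩, h3⟩
        exact ⟨x, h1, h2, h3.symm⟩
    rw [hS, Set.ncard_image_of_injOn, Set.ncard_coe_finset, Finset.card_range]
    intro x hx y hy hxy
    simp only [Finset.coe_range, Set.mem_Iio, lt_min_iff] at hx hy
    have h := congrArg (fun p => pv n p (n + 1 - j)) hxy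
    simp only [pvGG n j a _ (n + 1 - j) (by omega)] at h
    unfold FF at h
    split_ifs at h <;> omega
  · intro hlt
    ext w
    simp only [Set.mem_setOf_eq, ← and_assoc, char n j hj1 hj2 a]
    constructor
    · rintro ⟨p, ⟨x, ⟨h1, h2⟩, rfl⟩, rfl⟩
      refine ⟨n + 1 - j - x, ⟨by omega, by omega⟩, ?_⟩
      rw [wtGG n j hj1 hj2 a x h1 h2]
      have : ((n + 1 - j - x : ℕ) : ℤ) = (n:ℤ) + 1 - j - x := by omega
      rw [this]
      congr 1
      · congr 1 <;> congr 1 <;> ring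
      · congr 1 <;> ring
    · rintro ⟨m, ⟨h1, h2⟩, rfl⟩
      refine ⟨_, ⟨n + 1 - j - m, ⟨by omega, by omega⟩, rfl⟩, ?_⟩
      rw [wtGG n j hj1 hj2 a _ (by omega) (by omega)]
      have : ((n + 1 - j - m : ℕ) : ℤ) = (n:ℤ) + 1 - j - m := by omega
      rw [this]
      congr 1
      · congr 1 <;> congr 1 <;> ring
      · congr 1 <;> ring
  · intro hle
    ext w
    simp only [Set.mem_setOf_eq, ← and_assoc, char n j hj1 hj2 a]
    constructor
    · rintro ⟨p, ⟨x, ⟨h1, h2⟩, rfl⟩, rfl⟩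
      refine ⟨j - x, ⟨by omega, by omega⟩, ?_⟩
      rw [wtGG n j hj1 hj2 a x h1 h2]
      have : ((j - x : ℕ) : ℤ) = (j:ℤ) - x := by omega
      rw [this]
      congr 1
      · congr 1 <;> congr 1 <;> ring
      · congr 1 <;> ring
    · rintro ⟨m, ⟨h1, h2⟩, rfl⟩
      refine ⟨_, ⟨j - m, ⟨by omega, by omega⟩, rfl⟩, ?_⟩
      rw [wtGG n j hj1 hj2 a _ (by omega) (by omega)]
      have : ((j - m : ℕ) : ℤ) = (j:ℤ) - m := by omega
      rw [this]
      congr 1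
      · congr 1 <;> congr 1 <;> ring
      · congr 1 <;> ring
end

section
/- Fix n ≥ 1 and i ∈ {1,…,n}, and let a = (a₁,…,a_r) be an (i,n)-segment. For 1 ≤ j ≤ s ≤ r write a_{j,s} = (a_j,…,a_s). If (p_j,…,p_s) is a tuple of paths in 𝙿_{ω_{i,a_{j,s}}} (where ω_{i,a_{j,s}} = ω_{i,a_j}⋯ω_{i,a_s}), then the tuple (p_{i,a₁},…,p_{i,a_{j−1}}, p_j,…,p_s, p*_{i,a_{s+1}},…,p*_{i,a_r}) belongs to 𝙿_{ω_{i,a}}, where ω_{i,a} = ω_{i,a₁}⋯ω_{i,a_r}. -/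
/-- `p : {0,…,N+1} → ℤ` (modelled on `ℕ`) is a path in `𝙿^{(N)}_{i,a}`. -/
def IsPath (N i : ℕ) (a : ℤ) (p : ℕ → ℤ) : Prop :=
  p 0 = (i : ℤ) + a ∧ p (N + 1) = (N : ℤ) + 1 - i + a ∧
    ∀ r : ℕ, r ≤ N → (p (r + 1) - p r = 1 ∨ p (r + 1) - p r = -1)

/-- The path `p_{i,a}`. -/
def pLow (i : ℕ) (a : ℤ) (j : ℕ) : ℤ :=
  if j ≤ i then (i : ℤ) - j + a else (j : ℤ) - i + a

/-- The path `p*_{i,a}`. -/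
def pHigh (n i : ℕ) (a : ℤ) (j : ℕ) : ℤ :=
  if j ≤ n + 1 - i then a + i + j else a + 2 * (n : ℤ) + 2 - i - j

theorem path_lip (N i : ℕ) (a : ℤ) (p : ℕ → ℤ) (h : IsPath N i a p) (m k : ℕ)
    (hk : m + k ≤ N + 1) : p (m + k) - p m ≤ k ∧ -(k : ℤ) ≤ p (m + k) - p m := by
  induction k with
  | zero => simp
  | succ k ih =>
    have := ih (by omega)
    have h2 := h.2.2 (m + k) (by omega)
    rw [← add_assoc]
    push_cast
    omega

theorem path_bounds (N i : ℕ) (hi : i ≤ N) (a : ℤ) (p : ℕ → ℤ) (h : IsPath N i a p) (m : ℕ)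
    (hm : m ≤ N + 1) : pLow i a m ≤ p m ∧ p m ≤ pHigh N i a m := by
  have h1 := path_lip N i a p h 0 m (by omega)
  have h2 := path_lip N i a p h m (N + 1 - m) (by omega)
  rw [show m + (N + 1 - m) = N + 1 by omega, h.2.1] at h2
  rw [Nat.zero_add, h.1] at h1
  unfold pLow pHigh
  split_ifs <;> omega

theorem pLow_path (N i : ℕ) (hi : i ≤ N) (a : ℤ) : IsPath N i a (pLow i a) := by
  refine ⟨?_, ?_, fun r hr => ?_⟩ <;> unfold pLow <;> split_ifs <;> omega

theorem pHigh_path (N i : ℕ) (hi1 : 1 ≤ i) (hi : i ≤ N) (a : ℤ) : IsPath N i a (pHigh N i a) := by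
  refine ⟨?_, ?_, fun r hr => ?_⟩ <;> unfold pHigh <;> split_ifs <;> omega

theorem seg_lt_s10 (i n r : ℕ) (a : ℕ → ℤ) (ha : IsSeg i n r a) (t k : ℕ) (ht : 1 ≤ t)
    (hk : t + k + 1 ≤ r) : a t < a (t + k + 1) := by
  have step : ∀ p, 1 ≤ p → p + 1 ≤ r → a p < a (p + 1) := by
    intro p h1 h2
    obtain ⟨j, hj, -, h⟩ := ha (p + 1) (by omega) h2
    simp only [Nat.add_sub_cancel] at h
    omega
  induction k with
  | zero => exact step t ht hk
  | succ k ih => exact (ih (by omega)).trans (step (t + k + 1) (by omega) hk)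

theorem stmt10 (n i r : ℕ) (hn : 1 ≤ n) (hi1 : 1 ≤ i) (hi2 : i ≤ n) (hr : 1 ≤ r)
    (a : ℕ → ℤ) (ha : IsSeg i n r a)
    (j s : ℕ) (hj : 1 ≤ j) (hjs : j ≤ s) (hsr : s ≤ r)
    (p : ℕ → ℕ → ℤ)
    (hpath : ∀ t : ℕ, j ≤ t → t ≤ s → IsPath n i (a t) (p t))
    (hord : ∀ t u : ℕ, j ≤ t → t < u → u ≤ s → ∀ m : ℕ, m ≤ n + 1 → p t m < p u m) :
    (∀ t : ℕ, 1 ≤ t → t ≤ r →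
      IsPath n i (a t)
        (fun m => if t < j then pLow i (a t) m
                  else if t ≤ s then p t m else pHigh n i (a t) m)) ∧
    (∀ t u : ℕ, 1 ≤ t → t < u → u ≤ r → ∀ m : ℕ, m ≤ n + 1 →
      (if t < j then pLow i (a t) m else if t ≤ s then p t m else pHigh n i (a t) m) <
      (if u < j then pLow i (a u) m else if u ≤ s then p u m else pHigh n i (a u) m)) := by
  have H : ∀ t : ℕ, 1 ≤ t → t ≤ r →
      IsPath n i (a t)
        (fun m => if t < j then pLow i (a t) m
                  else if t ≤ s then p t m else pHigh n i (a t) m) := by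
    intro t h1 h2
    by_cases c1 : t < j
    · simp only [c1, if_true]; exact pLow_path n i hi2 _
    · by_cases c2 : t ≤ s
      · simp only [c1, c2, if_true, if_false]; exact hpath t (by omega) c2
      · simp only [c1, c2, if_false]; exact pHigh_path n i hi1 hi2 _
  refine ⟨H, fun t u ht htu hu m hm => ?_⟩
  have hlt : a t < a u := by
    have := seg_lt_s10 i n r a ha t (u - t - 1) ht (by omega)
    rwa [show t + (u - t - 1) + 1 = u by omega] at this
  have B1 := path_bounds n i hi2 _ _ (H t ht (by omega)) m hm
  have B2 := path_bounds n i hi2 _ _ (H u (by omega) hu) m hm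
  have L : pLow i (a t) m < pLow i (a u) m := by unfold pLow; split_ifs <;> omega
  have U : pHigh n i (a t) m < pHigh n i (a u) m := by unfold pHigh; split_ifs <;> omega
  by_cases c1 : t < j
  · simp only [c1, if_true] at B1 ⊢
    exact L.trans_le B2.1
  · by_cases c2 : u ≤ s
    · have e1 : ¬ u < j := by omega
      have e2 : t ≤ s := by omega
      simp only [c1, c2, e1, e2, if_true, if_false]
      exact hord t u (by omega) htu c2 m hm
    · have e1 : ¬ u < j := by omega
      simp only [e1, c2, if_false]
      exact B1.2.trans_lt U
end

section
/- Let i, ī, n be positive integers with n+1 = i(ī+1), let k ∈ [1,ī], a ∈ ℤ, and let p ∈ 𝙿^{(ī)}_{k,a}. Define Φ(p) : {0,…,n+1} → ℤ by Φ(p)(ij+j′) = i·p(j) + j′ if p(j+1) − p(j) = 1, and Φ(p)(ij+j′) = i·p(j) − j′ if p(j+1) − p(j) = −1, for j ∈ [0,ī] and j′ ∈ [0,i−1], and Φ(p)(n+1) = i·p(ī+1). Then Φ(p) ∈ 𝙿^{(n)}_{ik,ia} and ω(Φ(p)) = Φ(ω(p)) in P_n. -/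
/-- The weight `ω(p) = ∏_{r ∈ C_p⁺} ω_{r,p(r)} ∏_{r ∈ C_p⁻} ω_{r,p(r)}⁻¹` of a path,
as an element of the free abelian group `P_N` modelled additively on `(ℤ × ℤ) →₀ ℤ`. -/
noncomputable def wt (N : ℕ) (p : ℕ → ℤ) : (ℤ × ℤ) →₀ ℤ :=
  (∑ r ∈ Finset.Icc 1 N,
      if p (r - 1) = p r + 1 ∧ p (r + 1) = p r + 1 then
        Finsupp.single ((r : ℤ), p r) 1 else 0)
  - ∑ r ∈ Finset.Icc 1 N,
      if p (r - 1) = p r - 1 ∧ p (r + 1) = p r - 1 then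
        Finsupp.single ((r : ℤ), p r) 1 else 0

/-- The path `Φ(p)` of rank `n`, obtained by inflating a path `p` of rank `ī` by the
factor `i`: for `m = i·j + j'` with `0 ≤ j' ≤ i-1`, `Φ(p)(m) = i·p(j) ± j'` according to
whether `p(j+1) - p(j) = ±1` (and `Φ(p)(n+1) = i·p(ī+1)`). -/
def PhiPath (i : ℕ) (p : ℕ → ℤ) (m : ℕ) : ℤ :=
  if p (m / i + 1) - p (m / i) = 1 then (i : ℤ) * p (m / i) + ((m % i : ℕ) : ℤ)
  else (i : ℤ) * p (m / i) - ((m % i : ℕ) : ℤ)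

theorem phi_mul (i : ℕ) (hi : 1 ≤ i) (p : ℕ → ℤ) (j : ℕ) :
    PhiPath i p (i * j) = i * p j := by
  have h1 : i * j / i = j := Nat.mul_div_cancel_left j hi
  have h2 : i * j % i = 0 := Nat.mul_mod_right i j
  simp [PhiPath, h1, h2]

theorem phi_lt (i : ℕ) (p : ℕ → ℤ) (j s : ℕ) (hs : s < i)
    (hd : p (j + 1) - p j = 1 ∨ p (j + 1) - p j = -1) :
    PhiPath i p (i * j + s) = i * p j + s * (p (j + 1) - p j) := by
  have h1 : (i * j + s) / i = j := by
    rw [Nat.mul_add_div (by omega), Nat.div_eq_of_lt hs]; rfl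
  have h2 : (i * j + s) % i = s := by
    rw [Nat.mul_add_mod, Nat.mod_eq_of_lt hs]
  unfold PhiPath
  rw [h1, h2]
  rcases hd with h | h <;> rw [h] <;> simp
  ring

theorem phi_slope (i : ℕ) (p : ℕ → ℤ) (j s : ℕ) (hs : s < i)
    (hd : p (j + 1) - p j = 1 ∨ p (j + 1) - p j = -1) :
    PhiPath i p (i * j + s + 1) - PhiPath i p (i * j + s) = p (j + 1) - p j := by
  rw [phi_lt i p j s hs hd]
  by_cases h : s + 1 < i
  · rw [add_assoc, phi_lt i p j (s + 1) h hd]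
    push_cast; ring
  · have : i * j + s + 1 = i * (j + 1) := by
      have : i = s + 1 := by omega
      subst this; ring
    rw [this, phi_mul i (by omega)]
    have : (i : ℤ) = s + 1 := by omega
    rw [this]; ring

theorem sum_mul (i ib n : ℕ) (hi : 1 ≤ i) (hrel : n + 1 = i * (ib + 1))
    (f g : ℕ → ((ℤ × ℤ) →₀ ℤ))
    (h0 : ∀ j s, j ≤ ib → 1 ≤ s → s < i → f (i * j + s) = 0)
    (h1 : ∀ j, 1 ≤ j → j ≤ ib → f (i * j) = g j) :
    ∑ r ∈ Finset.Icc 1 n, f r = ∑ j ∈ Finset.Icc 1 ib, g j := by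
  symm
  apply Finset.sum_of_injOn (fun j => i * j)
  · intro x _ y _ h
    exact Nat.eq_of_mul_eq_mul_left hi h
  · intro x hx
    simp only [Finset.coe_Icc, Set.mem_Icc] at hx ⊢
    constructor
    · nlinarith
    · nlinarith
  · intro r hr hr'
    simp only [Finset.mem_Icc, Finset.coe_Icc, Set.mem_image, Set.mem_Icc] at hr hr'
    have hm := Nat.div_add_mod r i
    have hlt := Nat.mod_lt r hi
    have hq : r / i ≤ ib := by
      have : r / i < ib + 1 := Nat.div_lt_of_lt_mul (by omega)
      omega
    by_cases hz : r % i = 0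
    · exfalso
      apply hr'
      refine ⟨r / i, ⟨?_, hq⟩, by omega⟩
      rcases Nat.eq_zero_or_pos (r / i) with h | h
      · rw [h] at hm; omega
      · exact h
    · rw [← hm]
      exact h0 _ _ hq (by omega) hlt
  · intro j hj
    rw [Finset.mem_Icc] at hj
    exact (h1 j hj.1 hj.2).symm

theorem stmt11 (i ib n : ℕ) (hi : 1 ≤ i) (hib : 1 ≤ ib) (hn : 1 ≤ n)
    (hrel : n + 1 = i * (ib + 1))
    (k : ℕ) (hk1 : 1 ≤ k) (hk2 : k ≤ ib) (a : ℤ)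
    (p : ℕ → ℤ) (hp : IsPath ib k a p)
    (Φ : ((ℤ × ℤ) →₀ ℤ) →+ ((ℤ × ℤ) →₀ ℤ))
    (hΦ : ∀ (j : ℕ) (c : ℤ), 1 ≤ j → j ≤ ib →
      Φ (Finsupp.single ((j : ℤ), c) 1) = Finsupp.single (((i * j : ℕ) : ℤ), (i : ℤ) * c) 1) :
    IsPath n (i * k) ((i : ℤ) * a) (PhiPath i p) ∧
    wt n (PhiPath i p) = Φ (wt ib p) := by
  obtain ⟨hp0, hp1, hp2⟩ := hp
  -- the two slopes next to `i * j`
  have hcorner : ∀ j, 1 ≤ j → j ≤ ib →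
      PhiPath i p (i * j) = i * p j ∧
      PhiPath i p (i * j) - PhiPath i p (i * j - 1) = p j - p (j - 1) ∧
      PhiPath i p (i * j + 1) - PhiPath i p (i * j) = p (j + 1) - p j := by
    intro j hj1 hj2
    refine ⟨phi_mul i hi p j, ?_, phi_slope i p j 0 hi (hp2 j hj2)⟩
    obtain ⟨l, rfl⟩ : ∃ l, j = l + 1 := ⟨j - 1, by omega⟩
    have h := phi_slope i p l (i - 1) (by omega) (hp2 l (by omega))
    have e1 : i * (l + 1) - 1 = i * l + (i - 1) := by
      rw [mul_add]; omega
    have e2 : i * l + (i - 1) + 1 = i * (l + 1) := by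
      rw [mul_add]; omega
    rw [e2] at h
    rw [e1]; exact h
  have hinner : ∀ j s, j ≤ ib → 1 ≤ s → s < i →
      PhiPath i p (i * j + s) - PhiPath i p (i * j + s - 1) =
      PhiPath i p (i * j + s + 1) - PhiPath i p (i * j + s) := by
    intro j s hj h1 h2
    obtain ⟨t, rfl⟩ : ∃ t, s = t + 1 := ⟨s - 1, by omega⟩
    have h := phi_slope i p j t (by omega) (hp2 j hj)
    have h' := phi_slope i p j (t + 1) h2 (hp2 j hj)
    skip
    rw [h']
    exact h
  refine ⟨⟨?_, ?_, ?_⟩, ?_⟩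
  · have := phi_mul i hi p 0
    rw [mul_zero] at this
    rw [this, hp0]; push_cast; ring
  · rw [hrel, phi_mul i hi, hp1]
    have : (n : ℤ) + 1 = i * (ib + 1) := by exact_mod_cast hrel
    rw [this]; push_cast; ring
  · intro r hr
    have hq : r / i ≤ ib := by
      have : r / i < ib + 1 := Nat.div_lt_of_lt_mul (by omega)
      omega
    have h := phi_slope i p (r / i) (r % i) (Nat.mod_lt r hi) (hp2 _ hq)
    rw [Nat.div_add_mod] at h
    rw [h]; exact hp2 _ hq
  · unfold wt
    rw [map_sub, map_sum, map_sum]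
    congr 1
    · apply sum_mul i ib n hi hrel
      · intro j s hj h1 h2
        have := hinner j s hj h1 h2
        rw [if_neg]; omega
      · intro j h1 h2
        obtain ⟨ha, hb, hc⟩ := hcorner j h1 h2
        by_cases h : p (j - 1) = p j + 1 ∧ p (j + 1) = p j + 1
        · rw [if_pos h, if_pos (by omega), hΦ j _ h1 h2, ha]
        · rw [if_neg h, if_neg (by omega), map_zero]
    · apply sum_mul i ib n hi hrel
      · intro j s hj h1 h2
        have := hinner j s hj h1 h2
        rw [if_neg]; omega
      · intro j h1 h2
        obtain ⟨ha, hb, hc⟩ := hcorner j h1 h2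
        by_cases h : p (j - 1) = p j - 1 ∧ p (j + 1) = p j - 1
        · rw [if_pos h, if_pos (by omega), hΦ j _ h1 h2, ha]
        · rw [if_neg h, if_neg (by omega), map_zero]
end

section
/- Let i, ī, n be positive integers with n+1 = i(ī+1), let k ∈ [1,ī], a ∈ ℤ, and let g ∈ 𝙿^{(n)}_{ik,ia} be such that every m ∈ C_g⁺ ∪ C_g⁻ satisfies i ∣ m and i ∣ g(m) (equivalently, ω(g) lies in the image of Φ). Then i divides g(ir) for every r ∈ [0, ī+1], the function Φ⁻¹(g) : {0,…,ī+1} → ℤ defined by Φ⁻¹(g)(r) = g(ir)/i belongs to 𝙿^{(ī)}_{k,a}, and ω(g) = Φ(ω(Φ⁻¹(g))). -/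
/-- `C_p⁺ = {r ∈ [1,N] : p(r-1) = p(r) + 1 = p(r+1)}`. -/
def CplusN (N : ℕ) (p : ℕ → ℤ) : Set ℕ :=
  {r | 1 ≤ r ∧ r ≤ N ∧ p (r - 1) = p r + 1 ∧ p (r + 1) = p r + 1}

/-- `C_p⁻ = {r ∈ [1,N] : p(r-1) = p(r) - 1 = p(r+1)}`. -/
def CminusN (N : ℕ) (p : ℕ → ℤ) : Set ℕ :=
  {r | 1 ≤ r ∧ r ≤ N ∧ p (r - 1) = p r - 1 ∧ p (r + 1) = p r - 1}

theorem aux_block (i n r : ℕ) (g : ℕ → ℤ)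
    (hs : ∀ r : ℕ, r ≤ n → (g (r + 1) - g r = 1 ∨ g (r + 1) - g r = -1))
    (hdiv : ∀ m ∈ CplusN n g ∪ CminusN n g, (i ∣ m) ∧ ((i : ℤ) ∣ g m))
    (hr : i * r + i ≤ n + 1) :
    ∀ s : ℕ, s < i → g (i * r + s + 1) - g (i * r + s) = g (i * r + 1) - g (i * r) := by
  intro s
  induction s with
  | zero => intro _; simp
  | succ s ih =>
    intro h
    have ih := ih (by omega)
    rw [← ih]
    have hnd : ¬ i ∣ i * r + (s + 1) := by
      intro hd
      have := (Nat.dvd_add_right (Dvd.intro r rfl)).1 hd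
      have := Nat.le_of_dvd (by omega) this
      omega
    have h1 := hs (i * r + s) (by omega)
    have h2 := hs (i * r + s + 1) (by omega)
    have h3 : i * r + (s + 1) ∉ CplusN n g ∪ CminusN n g := fun hm => hnd (hdiv _ hm).1
    simp only [CplusN, CminusN, Set.mem_union, Set.mem_setOf_eq, not_or] at h3
    have e1 : i * r + (s + 1) - 1 = i * r + s := by omega
    rw [e1] at h3
    rw [← add_assoc] at h3 ⊢
    obtain ⟨h3, h4⟩ := h3
    have b1 : 1 ≤ i * r + s + 1 := by omega
    have b2 : i * r + s + 1 ≤ n := by omega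
    simp only [b1, b2, true_and, not_and] at h3 h4
    omega

theorem aux_lin (i n r : ℕ) (g : ℕ → ℤ)
    (hs : ∀ r : ℕ, r ≤ n → (g (r + 1) - g r = 1 ∨ g (r + 1) - g r = -1))
    (hdiv : ∀ m ∈ CplusN n g ∪ CminusN n g, (i ∣ m) ∧ ((i : ℤ) ∣ g m))
    (hr : i * r + i ≤ n + 1) :
    ∀ s : ℕ, s ≤ i → g (i * r + s) = g (i * r) + s * (g (i * r + 1) - g (i * r)) := by
  intro s
  induction s with
  | zero => intro _; simp
  | succ s ih =>
    intro h
    have ih := ih (by omega)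
    have := aux_block i n r g hs hdiv hr s (by omega)
    push_cast
    rw [← add_assoc]
    linarith

theorem aux_sum (i ib n : ℕ) (hi : 1 ≤ i) (hrel : n + 1 = i * (ib + 1))
    (g h : ℕ → ℤ) (e : ℤ)
    (hd : ∀ m, 1 ≤ m → m ≤ n → g (m - 1) = g m + e → g (m + 1) = g m + e → i ∣ m)
    (hgh : ∀ r, r ≤ ib + 1 → g (i * r) = i * h r)
    (h1 : ∀ r, r ≤ ib → g (i * r + 1) - g (i * r) = h (r + 1) - h r)
    (h2 : ∀ r, r ≤ ib → g (i * (r + 1)) - g (i * (r + 1) - 1) = h (r + 1) - h r)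
    (Φ : ((ℤ × ℤ) →₀ ℤ) →+ ((ℤ × ℤ) →₀ ℤ))
    (hΦ : ∀ (j : ℕ) (c : ℤ), 1 ≤ j → j ≤ ib →
      Φ (Finsupp.single ((j : ℤ), c) 1) = Finsupp.single (((i * j : ℕ) : ℤ), (i : ℤ) * c) 1) :
    (∑ r ∈ Finset.Icc 1 n, if g (r - 1) = g r + e ∧ g (r + 1) = g r + e then
        (Finsupp.single ((r : ℤ), g r) 1 : (ℤ × ℤ) →₀ ℤ) else 0)
    = Φ (∑ r ∈ Finset.Icc 1 ib, if h (r - 1) = h r + e ∧ h (r + 1) = h r + e then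
        (Finsupp.single ((r : ℤ), h r) 1 : (ℤ × ℤ) →₀ ℤ) else 0) := by
  rw [map_sum]
  symm
  apply Finset.sum_of_injOn (fun r => i * r)
  · intro x _ y _ hxy
    exact Nat.eq_of_mul_eq_mul_left hi hxy
  · intro r hr
    simp only [Finset.coe_Icc, Set.mem_Icc] at hr ⊢
    constructor
    · nlinarith
    · nlinarith
  · intro m hm hm'
    rw [if_neg]
    rintro ⟨ha, hb⟩
    rw [Finset.mem_Icc] at hm
    obtain ⟨r, rfl⟩ := hd m hm.1 hm.2 ha hb
    apply hm'
    refine ⟨r, ?_, rfl⟩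
    simp only [Finset.coe_Icc, Set.mem_Icc]
    constructor
    · by_contra hc
      have : r = 0 := by omega
      subst this
      simp at hm
    · have : i * r < i * (ib + 1) := by omega
      have := Nat.lt_of_mul_lt_mul_left this
      omega
  · intro r hr
    rw [Finset.mem_Icc] at hr
    obtain ⟨q, rfl⟩ : ∃ q, r = q + 1 := ⟨r - 1, by omega⟩
    have a1 := h1 (q + 1) hr.2
    have a2 := h2 q (by omega)
    have a3 := hgh (q + 1) (by omega)
    have c : (h (q + 1 - 1) = h (q + 1) + e ∧ h (q + 1 + 1) = h (q + 1) + e) ↔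
        (g (i * (q + 1) - 1) = g (i * (q + 1)) + e ∧
          g (i * (q + 1) + 1) = g (i * (q + 1)) + e) := by
      rw [Nat.add_sub_cancel]
      constructor <;> rintro ⟨x, y⟩ <;> constructor <;> linarith
    by_cases hc : h (q + 1 - 1) = h (q + 1) + e ∧ h (q + 1 + 1) = h (q + 1) + e
    · rw [if_pos hc, if_pos (c.1 hc), hΦ _ _ hr.1 hr.2, a3]
    · rw [if_neg hc, if_neg (fun x => hc (c.2 x)), map_zero]

theorem stmt12 (i ib n : ℕ) (hi : 1 ≤ i) (hib : 1 ≤ ib) (hn : 1 ≤ n)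
    (hrel : n + 1 = i * (ib + 1))
    (k : ℕ) (hk1 : 1 ≤ k) (hk2 : k ≤ ib) (a : ℤ)
    (g : ℕ → ℤ) (hg : IsPath n (i * k) ((i : ℤ) * a) g)
    (hdiv : ∀ m ∈ CplusN n g ∪ CminusN n g, (i ∣ m) ∧ ((i : ℤ) ∣ g m))
    (Φ : ((ℤ × ℤ) →₀ ℤ) →+ ((ℤ × ℤ) →₀ ℤ))
    (hΦ : ∀ (j : ℕ) (c : ℤ), 1 ≤ j → j ≤ ib →
      Φ (Finsupp.single ((j : ℤ), c) 1) = Finsupp.single (((i * j : ℕ) : ℤ), (i : ℤ) * c) 1) :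
    (∀ r : ℕ, r ≤ ib + 1 → (i : ℤ) ∣ g (i * r)) ∧
    IsPath ib k a (fun r => g (i * r) / i) ∧
    wt n g = Φ (wt ib (fun r => g (i * r) / i)) := by
  obtain ⟨g0, g1, hs⟩ := hg
  have hi0 : (i : ℤ) ≠ 0 := by positivity
  have hblk : ∀ r, r ≤ ib → i * r + i ≤ n + 1 := by
    intro r hr
    rw [hrel]
    nlinarith
  have hlin := fun r (hr : r ≤ ib) => aux_lin i n r g hs hdiv (hblk r hr)
  have hstep : ∀ r, r ≤ ib → g (i * (r + 1)) = g (i * r) + i * (g (i * r + 1) - g (i * r)) :=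
    fun r hr => hlin r hr i le_rfl
  have hdvd : ∀ r : ℕ, r ≤ ib + 1 → (i : ℤ) ∣ g (i * r) := by
    intro r
    induction r with
    | zero =>
      intro _
      rw [mul_zero, g0]
      exact ⟨k + a, by push_cast; ring⟩
    | succ r ih =>
      intro hr
      rw [hstep r (by omega)]
      exact dvd_add (ih (by omega)) (dvd_mul_right _ _)
  have hgh : ∀ r, r ≤ ib + 1 → g (i * r) = i * (g (i * r) / i) :=
    fun r hr => (Int.mul_ediv_cancel' (hdvd r hr)).symm
  have h1 : ∀ r, r ≤ ib →
      g (i * r + 1) - g (i * r) = g (i * (r + 1)) / i - g (i * r) / i := by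
    intro r hr
    have e1 := hgh r (by omega)
    have e2 := hgh (r + 1) (by omega)
    have e3 := hstep r hr
    apply mul_left_cancel₀ hi0
    linarith
  have h2 : ∀ r, r ≤ ib →
      g (i * (r + 1)) - g (i * (r + 1) - 1) = g (i * (r + 1)) / i - g (i * r) / i := by
    intro r hr
    rw [← h1 r hr]
    have := aux_block i n r g hs hdiv (hblk r hr) (i - 1) (by omega)
    have e1 : i * r + (i - 1) + 1 = i * (r + 1) := by rw [mul_add]; omega
    have e2 : i * r + (i - 1) = i * (r + 1) - 1 := by omega
    rw [e1, e2] at this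
    exact this
  refine ⟨hdvd, ⟨?_, ?_, ?_⟩, ?_⟩
  · apply mul_left_cancel₀ hi0
    have := hgh 0 (by omega)
    simp only [] 
    rw [← this, mul_zero, g0]
    push_cast; ring
  · apply mul_left_cancel₀ hi0
    have := hgh (ib + 1) le_rfl
    simp only []
    rw [← this, ← hrel, g1]
    have : (n : ℤ) + 1 = i * (ib + 1) := by exact_mod_cast hrel
    rw [this]
    push_cast; ring
  · intro r hr
    simp only []
    rw [← h1 r hr]
    apply hs
    have := hblk r hr
    omega
  · unfold wt
    rw [map_sub]
    simp only [sub_eq_add_neg (G := ℤ)]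
    congr 1
    · exact aux_sum i ib n hi hrel g _ 1
        (fun m x y z w => (hdiv m (Or.inl ⟨x, y, z, w⟩)).1) hgh h1 h2 Φ hΦ
    · congr 1
      exact aux_sum i ib n hi hrel g _ (-1)
        (fun m x y z w => (hdiv m (Or.inr ⟨x, y, z, w⟩)).1) hgh h1 h2 Φ hΦ
end

section
/- Let i, ī, n be positive integers with n+1 = i(ī+1) and let φ : P̄_ī → P̄_n be the group homomorphism with φ(ϖ_j) = ϖ_{ij} for j ∈ [1,ī]. Then φ(Q⁺_ī) ⊆ Q⁺_n, and for all λ, μ ∈ P̄_ī one has λ − μ ∈ Q⁺_ī if and only if φ(λ) − φ(μ) ∈ Q⁺_n. -/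
/-- Generator `ϖ_j` of the free abelian group `P̄_N` (modelled additively as `ℤ →₀ ℤ`),
with the convention `ϖ_j = 0` for `j ∉ [1,N]`. -/
noncomputable def vp (N : ℕ) (j : ℤ) : ℤ →₀ ℤ :=
  if 1 ≤ j ∧ j ≤ (N : ℤ) then Finsupp.single j 1 else 0

/-- The simple root `α_j = 2ϖ_j - ϖ_{j-1} - ϖ_{j+1}`. -/
noncomputable def al (N : ℕ) (j : ℤ) : ℤ →₀ ℤ :=
  2 • vp N j - vp N (j - 1) - vp N (j + 1)

/-- `Q⁺_N`: the submonoid of `P̄_N` generated by `α_1, …, α_N`, i.e. the set of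
nonnegative integer combinations of the simple roots. -/
noncomputable def Qplus (N : ℕ) : Set (ℤ →₀ ℤ) :=
  {x | ∃ c : ℕ → ℕ, x = ∑ j ∈ Finset.Icc 1 N, (c j : ℤ) • al N (j : ℤ)}

theorem vp_apply_aux (N : ℕ) (j k : ℤ) :
    vp N j k = if 1 ≤ k ∧ k ≤ (N : ℤ) then (if j = k then 1 else 0) else 0 := by
  unfold vp
  split_ifs <;> simp [Finsupp.single_apply] <;> omega

theorem sum_al_in (N : ℕ) (c : ℕ → ℕ) (h0 : c 0 = 0) (hN : c (N + 1) = 0) (k : ℕ) (hk : k < N) :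
    (∑ j ∈ Finset.Icc 1 N, (c j : ℤ) • al N (j : ℤ)) ((k + 1 : ℕ) : ℤ)
      = 2 * c (k + 1) - c k - c (k + 2) := by
  have e : ∀ j ∈ Finset.Icc 1 N, ((c j : ℤ) • al N (j : ℤ)) ((k + 1 : ℕ) : ℤ)
      = 2 * (if j = k + 1 then (c j : ℤ) else 0) - (if j = k + 2 then (c j : ℤ) else 0)
        - (if j = k then (c j : ℤ) else 0) := by
    intro j hj
    have h1 : (1:ℤ) ≤ ((k + 1 : ℕ) : ℤ) ∧ ((k + 1 : ℕ) : ℤ) ≤ (N : ℤ) := by omega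
    simp only [al, Finsupp.smul_apply, Finsupp.sub_apply, vp_apply_aux, if_pos h1, smul_eq_mul]
    have a1 : ((j:ℤ) = ((k + 1 : ℕ) : ℤ)) ↔ j = k + 1 := by omega
    have a2 : ((j:ℤ) - 1 = ((k + 1 : ℕ) : ℤ)) ↔ j = k + 2 := by omega
    have a3 : ((j:ℤ) + 1 = ((k + 1 : ℕ) : ℤ)) ↔ j = k := by omega
    simp only [a1, a2, a3]
    split_ifs <;> simp <;> ring
  rw [Finsupp.finsetSum_apply, Finset.sum_congr rfl e, Finset.sum_sub_distrib,
    Finset.sum_sub_distrib, ← Finset.mul_sum, Finset.sum_ite_eq', Finset.sum_ite_eq',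
    Finset.sum_ite_eq']
  have b1 : k + 1 ∈ Finset.Icc 1 N := by simp; omega
  rw [if_pos b1]
  have b2 : (if k + 2 ∈ Finset.Icc 1 N then (c (k+2) : ℤ) else 0) = c (k + 2) := by
    split_ifs with h
    · rfl
    · have : k + 2 = N + 1 := by simp at h; omega
      rw [this, hN]; rfl
  have b3 : (if k ∈ Finset.Icc 1 N then (c k : ℤ) else 0) = c k := by
    split_ifs with h
    · rfl
    · have : k = 0 := by simp at h; omega
      rw [this, h0]; rfl
  rw [b2, b3]; ring

theorem sum_al_out (N : ℕ) (c : ℕ → ℕ) (k : ℤ) (hk : ¬ (1 ≤ k ∧ k ≤ (N:ℤ))) :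
    (∑ j ∈ Finset.Icc 1 N, (c j : ℤ) • al N (j : ℤ)) k = 0 := by
  rw [Finsupp.finsetSum_apply]
  apply Finset.sum_eq_zero
  intro j _
  simp only [al, Finsupp.smul_apply, Finsupp.sub_apply, vp_apply_aux, if_neg hk]
  simp

theorem Qplus_char (N : ℕ) (x : ℤ →₀ ℤ) : x ∈ Qplus N ↔
    (∀ k : ℤ, ¬ (1 ≤ k ∧ k ≤ (N:ℤ)) → x k = 0) ∧
    ∃ c : ℕ → ℕ, c 0 = 0 ∧ c (N + 1) = 0 ∧
      ∀ k : ℕ, k < N → x ((k + 1 : ℕ) : ℤ) = 2 * c (k + 1) - c k - c (k + 2) := by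
  constructor
  · rintro ⟨c, hc⟩
    have : x = ∑ j ∈ Finset.Icc 1 N,
        (((fun j => if 1 ≤ j ∧ j ≤ N then c j else 0) j : ℕ) : ℤ) • al N (j : ℤ) := by
      rw [hc]
      apply Finset.sum_congr rfl
      intro j hj
      simp only
      rw [if_pos (by simpa using hj)]
    refine ⟨?_, fun j => if 1 ≤ j ∧ j ≤ N then c j else 0, by simp, by simp, ?_⟩
    · intro k hk
      rw [hc]; exact sum_al_out N c k hk
    · intro k hk
      rw [this]
      exact sum_al_in N _ (by simp) (by simp) k hk
  · rintro ⟨hx, c, h0, hN, h⟩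
    refine ⟨c, ?_⟩
    ext k
    by_cases hk : 1 ≤ k ∧ k ≤ (N:ℤ)
    · obtain ⟨m, rfl⟩ : ∃ m : ℕ, k = ((m + 1 : ℕ) : ℤ) := ⟨(k - 1).toNat, by omega⟩
      rw [sum_al_in N c h0 hN m (by omega), h m (by omega)]
    · rw [hx k hk, sum_al_out N c k hk]

theorem phi_expand (i ib n : ℕ) (φ : (ℤ →₀ ℤ) →+ (ℤ →₀ ℤ))
    (hφ : ∀ j : ℕ, 1 ≤ j → j ≤ ib → φ (vp ib (j : ℤ)) = vp n ((i * j : ℕ) : ℤ))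
    (x : ℤ →₀ ℤ) (hx : ∀ k : ℤ, ¬ (1 ≤ k ∧ k ≤ (ib:ℤ)) → x k = 0) :
    φ x = ∑ j ∈ Finset.Icc 1 ib, x (j : ℤ) • vp n ((i * j : ℕ) : ℤ) := by
  have e : x = ∑ j ∈ Finset.Icc 1 ib, x (j : ℤ) • vp ib (j : ℤ) := by
    ext k
    rw [Finsupp.finsetSum_apply]
    simp only [Finsupp.smul_apply, vp_apply_aux]
    by_cases hk : 1 ≤ k ∧ k ≤ (ib:ℤ)
    · simp only [if_pos hk]
      obtain ⟨m, rfl⟩ : ∃ m : ℕ, k = (m : ℤ) := ⟨k.toNat, by omega⟩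
      rw [Finset.sum_eq_single m]
      · simp
      · intro b _ hb
        simp [hb]
      · intro h; simp at h; omega
    · simp only [if_neg hk]; simp [hx k hk]
  conv_lhs => rw [e]
  rw [map_sum]
  apply Finset.sum_congr rfl
  intro j hj
  rw [Finset.mem_Icc] at hj
  rw [map_zsmul, hφ j hj.1 hj.2]

theorem main_iff (i ib n : ℕ) (hi : 1 ≤ i)
    (hrel : n + 1 = i * (ib + 1))
    (φ : (ℤ →₀ ℤ) →+ (ℤ →₀ ℤ))
    (hφ : ∀ j : ℕ, 1 ≤ j → j ≤ ib → φ (vp ib (j : ℤ)) = vp n ((i * j : ℕ) : ℤ))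
    (x : ℤ →₀ ℤ) (hx : ∀ k : ℤ, ¬ (1 ≤ k ∧ k ≤ (ib:ℤ)) → x k = 0) :
    x ∈ Qplus ib ↔ φ x ∈ Qplus n := by
  have hexp := phi_expand i ib n φ hφ x hx
  have hle : ∀ j, j ≤ ib → i * j ≤ n := by
    intro j hj
    have : i * j ≤ i * ib := Nat.mul_le_mul_left _ hj
    rw [Nat.mul_succ] at hrel
    omega
  have hout : ∀ k : ℤ, ¬ (1 ≤ k ∧ k ≤ (n:ℤ)) → φ x k = 0 := by
    intro k hk
    rw [hexp, Finsupp.finsetSum_apply]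
    simp [vp_apply_aux, hk]
  have hA : ∀ j : ℕ, 1 ≤ j → j ≤ ib → φ x ((i * j : ℕ) : ℤ) = x (j : ℤ) := by
    intro j h1 h2
    have h3 : (1:ℤ) ≤ ((i * j : ℕ) : ℤ) ∧ ((i * j : ℕ) : ℤ) ≤ (n : ℤ) := by
      have := hle j h2
      have := Nat.mul_le_mul hi h1
      omega
    rw [hexp, Finsupp.finsetSum_apply]
    simp only [Finsupp.smul_apply, vp_apply_aux, if_pos h3]
    rw [Finset.sum_eq_single j]
    · simp
    · intro b _ hb
      have : ((i * b : ℕ) : ℤ) ≠ ((i * j : ℕ) : ℤ) := by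
        intro h
        exact hb (Nat.eq_of_mul_eq_mul_left hi (by exact_mod_cast h))
      rw [if_neg this]; simp
    · intro h; simp at h; omega
  have hB : ∀ q r : ℕ, 1 ≤ r → r < i → φ x ((i * q + r : ℕ) : ℤ) = 0 := by
    intro q r h1 h2
    rw [hexp, Finsupp.finsetSum_apply]
    apply Finset.sum_eq_zero
    intro b _
    have : ((i * b : ℕ) : ℤ) ≠ ((i * q + r : ℕ) : ℤ) := by
      intro h
      have h' : i * b = i * q + r := by exact_mod_cast h
      have h3 : (i * b) % i = (i * q + r) % i := by rw [h']
      rw [Nat.mul_mod_right, Nat.mul_add_mod, Nat.mod_eq_of_lt h2] at h3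
      omega
    simp only [Finsupp.smul_apply, vp_apply_aux, if_neg this]
    simp
  rw [Qplus_char, Qplus_char]
  constructor
  · rintro ⟨-, c, h0, hN, h⟩
    refine ⟨hout, fun m => (i - m % i) * c (m / i) + (m % i) * c (m / i + 1), ?_, ?_, ?_⟩
    · simp [h0]
    · simp only [hrel, Nat.mul_mod_right, Nat.mul_div_cancel_left _ hi, hN]; simp
    · set d : ℕ → ℕ := fun m => (i - m % i) * c (m / i) + (m % i) * c (m / i + 1) with hd
      have hdd : ∀ q r, r ≤ i → (d (i * q + r) : ℤ) = (i - r) * c q + r * c (q + 1) := by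
        intro q r hr
        rcases Nat.lt_or_ge r i with h | h
        · simp only [hd, Nat.mul_add_mod, Nat.mod_eq_of_lt h, Nat.mul_add_div hi,
            Nat.div_eq_of_lt h]
          push_cast [hr]; simp
        · have : r = i := le_antisymm hr h
          subst this
          rw [← Nat.mul_succ]
          simp only [hd, Nat.mul_mod_right, Nat.mul_div_cancel_left _ hi]
          push_cast; simp
      intro k hk
      obtain ⟨q, r, hr, hqr⟩ : ∃ q r, r < i ∧ k = i * q + r :=
        ⟨k / i, k % i, Nat.mod_lt _ hi, (Nat.div_add_mod k i).symm⟩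
      change _ = 2 * (d (k+1) : ℤ) - d k - d (k+2)
      have e0 := hdd q r hr.le
      have e1 := hdd q (r+1) hr
      rw [← hqr] at e0
      rw [← add_assoc, ← hqr] at e1
      rcases Nat.lt_or_ge (r+1) i with h1 | h1
      · have e2 := hdd q (r+2) h1
        rw [← add_assoc, ← hqr] at e2
        rw [e0, e1, e2]
        have := hB q (r+1) (by omega) h1
        rw [← add_assoc, ← hqr] at this
        rw [this]; push_cast; ring
      · have hri : r + 1 = i := by omega
        have hk1 : k + 1 = i * (q + 1) := by rw [Nat.mul_succ]; omega
        have e2 := hdd (q+1) 1 hi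
        rw [← hk1] at e2
        have hq : q < ib := by
          by_contra hq
          have : i * (ib + 1) ≤ i * (q+1) := Nat.mul_le_mul_left _ (by omega)
          omega
        have := hA (q+1) (by omega) (by omega)
        rw [← hk1, h q hq] at this
        rw [this, e0, e1, show k + 2 = k + 1 + 1 from rfl, e2]
        have hz : (i:ℤ) = r + 1 := by exact_mod_cast hri.symm
        rw [hz]; push_cast; ring
  · rintro ⟨-, d, h0, hN, h⟩
    refine ⟨hx, ?_⟩
    have hlin : ∀ q, q ≤ ib → ∀ r, (r + 1 ≤ i →
        (d (i * q + r) : ℤ) = d (i*q) + r * (d (i*q+1) - d (i*q)) ∧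
        (d (i * q + (r+1)) : ℤ) = d (i*q) + (r+1) * (d (i*q+1) - d (i*q))) := by
      intro q hq r
      induction r with
      | zero => intro _; simp
      | succ r ih =>
        intro hr
        obtain ⟨a, b⟩ := ih (by omega)
        refine ⟨by push_cast; exact b, ?_⟩
        have hk : i * q + r < n := by
          have : i * q ≤ i * ib := Nat.mul_le_mul_left _ hq
          rw [Nat.mul_succ] at hrel
          omega
        have h1 := h _ hk
        have h2 := hB q (r+1) (by omega) (by omega)
        rw [← add_assoc] at h2
        rw [h2] at h1
        rw [← add_assoc] at b
        rw [a, b] at h1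
        rw [show i * q + (r + 1 + 1) = i * q + r + 2 by ring]
        push_cast
        linarith
    have hi' : i - 1 + 1 = i := by omega
    have hstep : ∀ q, q ≤ ib → (d (i * (q+1)) : ℤ) = d (i*q) + i * (d (i*q+1) - d (i*q)) := by
      intro q hq
      have := (hlin q hq (i-1) (by omega)).2
      rw [hi', ← Nat.mul_succ] at this
      have hz : ((i - 1 : ℕ) : ℤ) + 1 = i := by exact_mod_cast hi'
      rw [hz] at this
      exact this
    have hdvd : ∀ q, q ≤ ib + 1 → (i:ℤ) ∣ d (i * q) := by
      intro q
      induction q with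
      | zero => intro _; simp [h0]
      | succ q ih =>
        intro hq
        rw [hstep q (by omega)]
        exact dvd_add (ih (by omega)) (dvd_mul_right _ _)
    have hiz : (i:ℤ) ≠ 0 := by omega
    have he : ∀ q, q ≤ ib + 1 → (d (i * q) : ℤ) = i * ((d (i * q) / i : ℕ) : ℤ) := by
      intro q hq
      have := hdvd q hq
      rw [Int.natCast_dvd_natCast] at this
      exact_mod_cast (Nat.mul_div_cancel' this).symm
    refine ⟨fun q => d (i * q) / i, by simp [h0], by simp [← hrel, hN], ?_⟩
    intro q hq
    have hk1 : i * q + (i - 1) + 1 = i * (q + 1) := by rw [Nat.mul_succ]; omega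
    have hlt : i * q + (i - 1) < n := by
      have := hle (q+1) (by omega)
      omega
    have h1 := h _ hlt
    rw [show i * q + (i - 1) + 2 = i * q + (i - 1) + 1 + 1 from rfl, hk1,
      hA (q+1) (by omega) (by omega), (hlin q (by omega) (i-1) (by omega)).1] at h1
    have hz : ((i - 1 : ℕ) : ℤ) = i - 1 := by omega
    rw [hz] at h1
    have s1 := hstep q (by omega)
    have s2 := hstep (q+1) (by omega)
    have f0 := he q (by omega)
    have f1 := he (q+1) (by omega)
    have f2 := he (q+2) (by omega)
    apply mul_left_cancel₀ hiz
    simp only [mul_sub, mul_left_comm (i:ℤ) 2]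
    rw [← f0, ← f1, ← f2, h1]
    rw [show q + 1 + 1 = q + 2 from rfl] at s2
    rw [s2]
    linear_combination ((i:ℤ) - 1) * s1

theorem stmt13 (i ib n : ℕ) (hi : 1 ≤ i) (hib : 1 ≤ ib) (hn : 1 ≤ n)
    (hrel : n + 1 = i * (ib + 1))
    (φ : (ℤ →₀ ℤ) →+ (ℤ →₀ ℤ))
    (hφ : ∀ j : ℕ, 1 ≤ j → j ≤ ib → φ (vp ib (j : ℤ)) = vp n ((i * j : ℕ) : ℤ)) :
    (∀ x ∈ Qplus ib, φ x ∈ Qplus n) ∧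
    (∀ lam mu : ℤ →₀ ℤ,
      (∀ j : ℤ, lam j ≠ 0 → 1 ≤ j ∧ j ≤ (ib : ℤ)) →
      (∀ j : ℤ, mu j ≠ 0 → 1 ≤ j ∧ j ≤ (ib : ℤ)) →
      (lam - mu ∈ Qplus ib ↔ φ lam - φ mu ∈ Qplus n)) := by
  constructor
  · intro x hx
    exact (main_iff i ib n hi hrel φ hφ x ((Qplus_char ib x).1 hx).1).1 hx
  · intro lam mu hl hm
    rw [← map_sub]
    apply main_iff i ib n hi hrel φ hφ
    intro k hk
    have a : lam k = 0 := by
      by_contra h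
      exact hk (hl k h)
    have b : mu k = 0 := by
      by_contra h
      exact hk (hm k h)
    simp [a, b]
end

section
/- Let i, ī, n be positive integers with n+1 = i(ī+1) and let φ : P̄_ī → P̄_n be the group homomorphism with φ(ϖ_j) = ϖ_{ij} for j ∈ [1,ī]. Then for every j ∈ [1,ī], φ(α_j) = Σ_{p=1}^{i} Σ_{s=p−i}^{i−p} α_{ij+s} in P̄_n (where α_j on the left is formed in P̄_ī and the α's on the right in P̄_n). -/
theorem al_inner_sum (n : ℕ) (c : ℤ) (m : ℕ) :
    ∑ s ∈ Finset.Icc (-(m : ℤ)) (m : ℤ), al n (c + s) =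
      vp n (c - m) - vp n (c - (m + 1 : ℕ)) + (vp n (c + m) - vp n (c + (m + 1 : ℕ))) := by
  induction m with
  | zero => simp [al]; abel
  | succ m ih =>
    have h : Finset.Icc (-((m + 1 : ℕ) : ℤ)) ((m + 1 : ℕ) : ℤ) =
        insert (-((m + 1 : ℕ) : ℤ)) (insert ((m + 1 : ℕ) : ℤ) (Finset.Icc (-(m : ℤ)) (m : ℤ))) := by
      ext x
      simp only [Finset.mem_Icc, Finset.mem_insert]
      omega
    rw [h, Finset.sum_insert, Finset.sum_insert, ih]
    · simp only [al]
      have e1 : c + -((m + 1 : ℕ) : ℤ) = c - (m + 1 : ℕ) := by ring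
      have e2 : c - ((m + 1 : ℕ) : ℤ) - 1 = c - (m + 1 + 1 : ℕ) := by push_cast; ring
      have e3 : c - ((m + 1 : ℕ) : ℤ) + 1 = c - m := by push_cast; ring
      have e4 : c + ((m + 1 : ℕ) : ℤ) - 1 = c + m := by push_cast; ring
      have e5 : c + ((m + 1 : ℕ) : ℤ) + 1 = c + (m + 1 + 1 : ℕ) := by push_cast; ring
      rw [e1, e2, e3, e4, e5]
      abel
    · simp
    · simp only [Finset.mem_Icc, Finset.mem_insert]
      omega

theorem al_outer_sum (n : ℕ) (c : ℤ) (i : ℕ) :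
    ∑ m ∈ Finset.range i, ∑ s ∈ Finset.Icc (-(m : ℤ)) (m : ℤ), al n (c + s) =
      2 • vp n c - vp n (c - i) - vp n (c + i) := by
  induction i with
  | zero => simp; abel
  | succ i ih =>
    rw [Finset.sum_range_succ, ih, al_inner_sum]
    abel

theorem al_reindex (n : ℕ) (c : ℤ) (i : ℕ) :
    ∑ p ∈ Finset.Icc 1 i, ∑ s ∈ Finset.Icc ((p : ℤ) - (i : ℤ)) ((i : ℤ) - (p : ℤ)), al n (c + s) =
    ∑ m ∈ Finset.range i, ∑ s ∈ Finset.Icc (-(m : ℤ)) (m : ℤ), al n (c + s) := by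
  refine Finset.sum_nbij' (fun p => i - p) (fun m => i - m) ?_ ?_ ?_ ?_ ?_
  · intro p hp; simp only [Finset.mem_Icc, Finset.mem_range] at *; omega
  · intro p hp; simp only [Finset.mem_Icc, Finset.mem_range] at *; omega
  · intro p hp; simp only [Finset.mem_Icc] at *; omega
  · intro p hp; simp only [Finset.mem_range] at *; omega
  · intro p hp
    simp only [Finset.mem_Icc] at hp
    rw [Nat.cast_sub hp.2, neg_sub]

theorem stmt14 (i ib n : ℕ) (hi : 1 ≤ i) (hib : 1 ≤ ib) (hn : 1 ≤ n)
    (hrel : n + 1 = i * (ib + 1))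
    (φ : (ℤ →₀ ℤ) →+ (ℤ →₀ ℤ))
    (hφ : ∀ j : ℕ, 1 ≤ j → j ≤ ib → φ (vp ib (j : ℤ)) = vp n ((i * j : ℕ) : ℤ)) :
    ∀ j : ℕ, 1 ≤ j → j ≤ ib →
      φ (al ib (j : ℤ)) =
        ∑ p ∈ Finset.Icc 1 i, ∑ s ∈ Finset.Icc ((p : ℤ) - (i : ℤ)) ((i : ℤ) - (p : ℤ)),
          al n ((i : ℤ) * (j : ℤ) + s) := by
  intro j hj1 hj2
  rw [al_reindex, al_outer_sum]
  have key : ∀ k : ℕ, k ≤ ib + 1 → φ (vp ib (k : ℤ)) = vp n ((i : ℤ) * (k : ℤ)) := by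
    intro k hk
    by_cases h0 : k = 0
    · subst h0; simp [vp]
    by_cases h1 : k = ib + 1
    · subst h1
      have h2 : (i : ℤ) * ((ib + 1 : ℕ) : ℤ) = n + 1 := by exact_mod_cast hrel.symm
      rw [h2]
      simp [vp]
    · rw [hφ k (by omega) (by omega)]
      push_cast
      rfl
  obtain ⟨k, rfl⟩ : ∃ k, j = k + 1 := ⟨j - 1, by omega⟩
  have a1 := key k (by omega)
  have a2 := key (k + 1) (by omega)
  have a3 := key (k + 1 + 1) (by omega)
  have e1 : ((k + 1 : ℕ) : ℤ) - 1 = k := by push_cast; ring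
  have e2 : ((k + 1 : ℕ) : ℤ) + 1 = (k + 1 + 1 : ℕ) := by push_cast; ring
  have e3 : (i : ℤ) * ((k + 1 : ℕ) : ℤ) - i = i * k := by push_cast; ring
  have e4 : (i : ℤ) * ((k + 1 : ℕ) : ℤ) + i = i * (k + 1 + 1 : ℕ) := by push_cast; ring
  rw [al, e1, e2, e3, e4, map_sub, map_sub, map_nsmul, a1, a2, a3]
end

section
/- Let i, ī, n be positive integers with n+1 = i(ī+1). Suppose k ∈ [1,ī] and a ∈ ℤ satisfy a ≤ 0 and k − a ∈ 2ℤ (so that ω_{ik,ia} ∈ H_{ī,n}), and let p ∈ 𝙿^{(n)}_{ik,ia} be such that ω(p) ∉ H_{ī,n}. Then there exists s ∈ C_p⁻ such that ω_{s,p(s)} ∉ H_{ī,n} and p(s) > p(j) for every j ∈ C_p⁺ with ω_{j,p(j)} ∉ H_{ī,n}. -/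
/-- The subgroup `H_{ī,n}` of `P_n` generated by the
`ω_{ij,ia}` with `j ∈ [1,ī]`, `a ≤ 0` and `j - a` even. -/
noncomputable def Hsub (i ib : ℕ) : AddSubgroup ((ℤ × ℤ) →₀ ℤ) :=
  AddSubgroup.closure {x | ∃ (j : ℕ) (a : ℤ), 1 ≤ j ∧ j ≤ ib ∧ a ≤ 0 ∧
    Even ((j : ℤ) - a) ∧ x = Finsupp.single (((i * j : ℕ) : ℤ), (i : ℤ) * a) 1}

lemma og_mem (i ib n : ℕ) (hi : 1 ≤ i) (hrel : n + 1 = i * (ib + 1)) (r : ℕ) (hr1 : 1 ≤ r)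
    (hr2 : r ≤ n) (c : ℤ) (u v : ℤ) (h1 : c + r = 2 * i * u) (h2 : c - r = 2 * i * v)
    (hc : c ≤ 0) : og n (r : ℤ) c ∈ Hsub i ib := by
  have hi' : (0 : ℤ) < i := by exact_mod_cast hi
  have e1 : (r : ℤ) = i * (u - v) := by linarith
  have e2 : c = i * (u + v) := by linarith
  have hpos : 0 < u - v := by
    by_contra h
    have : (i : ℤ) * (u - v) ≤ 0 := mul_nonpos_of_nonneg_of_nonpos hi'.le (by omega)
    omega
  have hle : u - v < ib + 1 := by
    have hz : (n : ℤ) + 1 = i * (ib + 1) := by exact_mod_cast hrel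
    have : (i : ℤ) * (u - v) < i * (ib + 1) := by rw [← e1, ← hz]; omega
    exact lt_of_mul_lt_mul_left this hi'.le
  have hb : u + v ≤ 0 := by
    by_contra h
    have : (0 : ℤ) < i * (u + v) := mul_pos hi' (by omega)
    omega
  unfold og
  rw [if_pos ⟨by omega, by omega⟩]
  apply AddSubgroup.subset_closure
  have ht : (((u - v).toNat : ℕ) : ℤ) = u - v := Int.toNat_of_nonneg hpos.le
  refine ⟨(u - v).toNat, u + v, by omega, by omega, hb, ?_, ?_⟩
  · rw [ht]; exact ⟨-v, by ring⟩
  · push_cast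
    rw [ht, ← e1, ← e2]

lemma mem_H_supp (i ib : ℕ) (f : (ℤ × ℤ) →₀ ℤ) (hf : f ∈ Hsub i ib) (q : ℤ × ℤ) (hq : f q ≠ 0) :
    ∃ u v : ℤ, q.2 + q.1 = 2 * i * u ∧ q.2 - q.1 = 2 * i * v ∧ q.2 ≤ 0 := by
  unfold Hsub at hf
  revert q
  induction hf using AddSubgroup.closure_induction with
  | mem x hx =>
    intro q hq
    obtain ⟨j, a, h1, h2, h3, ⟨w, hw⟩, rfl⟩ := hx
    rw [Finsupp.single_apply] at hq
    split_ifs at hq with h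
    · subst h
      refine ⟨a + w, a + w - j, ?_, ?_, ?_⟩
      · have : (j : ℤ) = a + w + w := by linarith
        push_cast; rw [this]; ring
      · have : (j : ℤ) = a + w + w := by linarith
        push_cast; rw [this]; ring
      · exact mul_nonpos_of_nonneg_of_nonpos (by positivity) h3
    · exact absurd rfl hq
  | zero => intro q hq; exact absurd rfl hq
  | add x y _ _ ihx ihy =>
    intro q hq
    by_cases h : x q = 0
    · apply ihy
      intro h'
      apply hq
      simp [h, h']
    · exact ihx q h
  | neg x _ ih =>
    intro q hq
    apply ih
    simpa using hq

lemma mem_og (i ib n : ℕ) (r : ℕ) (hr1 : 1 ≤ r)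
    (hr2 : r ≤ n) (c : ℤ) (h : og n (r : ℤ) c ∈ Hsub i ib) :
    ∃ u v : ℤ, c + r = 2 * i * u ∧ c - r = 2 * i * v ∧ c ≤ 0 := by
  unfold og at h
  rw [if_pos ⟨by omega, by omega⟩] at h
  exact mem_H_supp i ib _ h ((r : ℤ), c) (by simp)

lemma left_walk (n : ℕ) (p : ℕ → ℤ)
    (hs : ∀ r : ℕ, r ≤ n → (p (r + 1) - p r = 1 ∨ p (r + 1) - p r = -1)) (m : ℕ) :
    m ≤ n → p m = p (m + 1) + 1 → ∃ s ≤ m, p s + s = p m + m ∧ (s = 0 ∨ s ∈ CminusN n p) := by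
  induction m with
  | zero => intro _ _; exact ⟨0, le_rfl, rfl, Or.inl rfl⟩
  | succ m ih =>
    intro hm h
    rcases hs m (by omega) with h1 | h1
    · refine ⟨m + 1, le_rfl, rfl, Or.inr ⟨by omega, hm, ?_, by omega⟩⟩
      simp only [Nat.add_sub_cancel]; omega
    · obtain ⟨s, hs1, hs2, hs3⟩ := ih (by omega) (by omega)
      exact ⟨s, by omega, by push_cast; omega, hs3⟩

lemma right_walk (n : ℕ) (p : ℕ → ℤ)
    (hs : ∀ r : ℕ, r ≤ n → (p (r + 1) - p r = 1 ∨ p (r + 1) - p r = -1)) (d : ℕ) :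
    ∀ m, m + d = n → p (m + 1) = p m + 1 →
      ∃ s, m + 1 ≤ s ∧ p s - s = p m - m ∧ (s = n + 1 ∨ s ∈ CminusN n p) := by
  induction d with
  | zero => intro m hm h; exact ⟨m + 1, le_rfl, by push_cast; omega, Or.inl (by omega)⟩
  | succ d ih =>
    intro m hm h
    rcases hs (m + 1) (by omega) with h1 | h1
    · obtain ⟨s, hs1, hs2, hs3⟩ := ih (m + 1) (by omega) (by omega)
      exact ⟨s, by omega, by push_cast at hs2; omega, hs3⟩
    · refine ⟨m + 1, le_rfl, by push_cast; omega, Or.inr ⟨by omega, by omega, ?_, by omega⟩⟩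
      simp only [Nat.add_sub_cancel]; omega

lemma wt_mem (i ib n : ℕ) (p : ℕ → ℤ)
    (h1 : ∀ j ∈ CplusN n p, og n (j : ℤ) (p j) ∈ Hsub i ib)
    (h2 : ∀ j ∈ CminusN n p, og n (j : ℤ) (p j) ∈ Hsub i ib) : wt n p ∈ Hsub i ib := by
  unfold wt
  apply AddSubgroup.sub_mem
  · apply AddSubgroup.sum_mem
    intro r hr
    rw [Finset.mem_Icc] at hr
    split_ifs with h
    · have := h1 r ⟨hr.1, hr.2, h⟩
      unfold og at this
      rwa [if_pos ⟨by omega, by omega⟩] at this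
    · exact AddSubgroup.zero_mem _
  · apply AddSubgroup.sum_mem
    intro r hr
    rw [Finset.mem_Icc] at hr
    split_ifs with h
    · have := h2 r ⟨hr.1, hr.2, h⟩
      unfold og at this
      rwa [if_pos ⟨by omega, by omega⟩] at this
    · exact AddSubgroup.zero_mem _

theorem stmt16 (i ib n : ℕ) (hi : 1 ≤ i) (hib : 1 ≤ ib) (hn : 1 ≤ n)
    (hrel : n + 1 = i * (ib + 1))
    (k : ℕ) (hk1 : 1 ≤ k) (hk2 : k ≤ ib) (a : ℤ) (ha : a ≤ 0)
    (hpar : Even ((k : ℤ) - a))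
    (p : ℕ → ℤ) (hp : IsPath n (i * k) ((i : ℤ) * a) p)
    (hnot : wt n p ∉ Hsub i ib) :
    ∃ s ∈ CminusN n p, og n (s : ℤ) (p s) ∉ Hsub i ib ∧
      ∀ j ∈ CplusN n p, og n (j : ℤ) (p j) ∉ Hsub i ib → p j < p s := by

  obtain ⟨hp0, hpn, hst⟩ := hp
  by_cases hB : ∀ j ∈ CplusN n p, og n (j : ℤ) (p j) ∈ Hsub i ib
  · by_contra hcon
    apply hnot
    apply wt_mem i ib n p hB
    intro s hs
    by_contra hbad
    exact hcon ⟨s, hs, hbad, fun j hj hj' => absurd (hB j hj) hj'⟩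
  push Not at hB
  obtain ⟨j0, hj0, hj0'⟩ := hB
  have hfin : {j | j ∈ CplusN n p ∧ og n (j : ℤ) (p j) ∉ Hsub i ib}.Finite :=
    (Set.finite_Iic n).subset (fun j hj => hj.1.2.1)
  obtain ⟨j, ⟨hj, hjbad⟩, hmax⟩ := Set.exists_max_image _ p hfin ⟨j0, hj0, hj0'⟩
  by_contra hcon
  have key : ∀ s ∈ CminusN n p, p j < p s → og n (s : ℤ) (p s) ∈ Hsub i ib := by
    intro s hs hlt
    by_contra hbad
    exact hcon ⟨s, hs, hbad, fun j' hj' hb => lt_of_le_of_lt (hmax j' ⟨hj', hb⟩) hlt⟩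
  obtain ⟨hj1, hj2, hj3, hj4⟩ := hj
  obtain ⟨w, hw⟩ := hpar
  have hk : (k : ℤ) = a + w + w := by linarith
  have hz : (n : ℤ) + 1 = i * (ib + 1) := by exact_mod_cast hrel
  push_cast at hp0 hpn
  have L : ∃ u : ℤ, p j + j = 2 * i * u ∧ (p j < 0 ∨ p j + j = i * k + i * a) := by
    obtain ⟨s, hs1, hs2, hs3⟩ := left_walk n p hst (j - 1) (by omega)
      (by rw [Nat.sub_add_cancel hj1]; exact hj3)
    have hjc : ((j - 1 : ℕ) : ℤ) = j - 1 := by omega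
    rcases hs3 with rfl | hs3
    · refine ⟨a + w, ?_, Or.inr ?_⟩
      · have : (i : ℤ) * k + i * a = 2 * i * (a + w) := by rw [hk]; ring
        push_cast at hs2; omega
      · push_cast at hs2; omega
    · obtain ⟨u, v, h1, h2, h3⟩ := mem_og i ib n s hs3.1 hs3.2.1 _ (key s hs3 (by omega))
      exact ⟨u, by omega, Or.inl (by omega)⟩
  have R : ∃ v : ℤ, p j - j = 2 * i * v ∧ (p j < 0 ∨ p j - j = i * a - i * k) := by
    obtain ⟨s, hs1, hs2, hs3⟩ := right_walk n p hst (n - j) j (by omega) hj4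
    rcases hs3 with rfl | hs3
    · refine ⟨-w, ?_, Or.inr ?_⟩
      · have : (i : ℤ) * a - i * k = 2 * i * (-w) := by rw [hk]; ring
        push_cast at hs2; omega
      · push_cast at hs2; omega
    · obtain ⟨u, v, h1, h2, h3⟩ := mem_og i ib n s hs3.1 hs3.2.1 _ (key s hs3 (by omega))
      exact ⟨v, by omega, Or.inl (by omega)⟩
  obtain ⟨u, hu, hu'⟩ := L
  obtain ⟨v, hv, hv'⟩ := R
  apply hjbad
  refine og_mem i ib n hi hrel j hj1 hj2 _ u v hu hv ?_
  have hia : (i : ℤ) * a ≤ 0 := mul_nonpos_of_nonneg_of_nonpos (by positivity) ha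
  rcases hu' with h | h
  · omega
  · rcases hv' with h' | h' <;> omega
end

section
/- Let i, ī, n be positive integers with n+1 = i(ī+1), and let ω = ω_{i₁,a₁}⋯ω_{i_k,a_k} ∈ P_ī⁺ with a₁ ≤ ⋯ ≤ a_k be a prime snake, so that Φ(ω) = ω_{ii₁,ia₁}⋯ω_{ii_k,ia_k} ∈ P_n⁺. Then for every π ∈ P_ī the following are equivalent: (1) there exists a tuple (p₁,…,p_k) ∈ 𝙿_ω (paths of rank ī) with π = ω(p₁)⋯ω(p_k); (2) there exists a tuple (g₁,…,g_k) ∈ 𝙿_{Φ(ω)} (paths of rank n) with Φ(π) = ω(g₁)⋯ω(g_k). -/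
/-- A tuple `(P 1, …, P k) ∈ 𝙿_ω` for `ω = ω_{idx 1, a 1} ⋯ ω_{idx k, a k}`:
each `P t` is a path in `𝙿^{(N)}_{idx t, a t}`, and `P t m < P u m` for all
`t < u` and all `m ∈ [0, N+1]`. -/
def IsTuple (N k : ℕ) (idx : ℕ → ℕ) (a : ℕ → ℤ) (P : ℕ → ℕ → ℤ) : Prop :=
  (∀ t : ℕ, 1 ≤ t → t ≤ k → IsPath N (idx t) (a t) (P t)) ∧
  (∀ t u : ℕ, 1 ≤ t → t < u → u ≤ k → ∀ m : ℕ, m ≤ N + 1 → P t m < P u m)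

def fS (i : ℕ) : ℤ × ℤ → ℤ × ℤ := fun x => ((i : ℤ) * x.1, (i : ℤ) * x.2)

lemma fS_inj (i : ℕ) (hi : 1 ≤ i) : Function.Injective (fS i) := by
  rintro ⟨x, y⟩ ⟨z, w⟩ h
  have h0 : i ≠ 0 := by omega
  simpa [fS, h0] using h

lemma Phi_eq (i ib : ℕ)
    (Φ : ((ℤ × ℤ) →₀ ℤ) →+ ((ℤ × ℤ) →₀ ℤ))
    (hΦ : ∀ (j : ℕ) (c : ℤ), 1 ≤ j → j ≤ ib →
      Φ (Finsupp.single ((j : ℤ), c) 1) = Finsupp.single (((i * j : ℕ) : ℤ), (i : ℤ) * c) 1)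
    (π : (ℤ × ℤ) →₀ ℤ) (hπ : ∀ x : ℤ × ℤ, π x ≠ 0 → 1 ≤ x.1 ∧ x.1 ≤ (ib : ℤ)) :
    Φ π = Finsupp.mapDomain (fS i) π := by
  conv_lhs => rw [← Finsupp.sum_single π]
  rw [Finsupp.mapDomain, Finsupp.sum, map_sum, Finsupp.sum]
  apply Finset.sum_congr rfl
  rintro ⟨x, y⟩ hx
  have h := hπ _ (Finsupp.mem_support_iff.1 hx)
  simp only at h
  obtain ⟨j, rfl⟩ : ∃ j : ℕ, x = j := ⟨x.toNat, by omega⟩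
  have e : ∀ (z : ℤ × ℤ) (b : ℤ), Finsupp.single z b = b • Finsupp.single z (1 : ℤ) := by
    intro z b; simp
  rw [e, map_zsmul, hΦ j y (by omega) (by omega), e (fS i _)]
  simp [fS]

lemma wt_apply (N : ℕ) (p : ℕ → ℤ) (r : ℕ) (c : ℤ) (h1 : 1 ≤ r) (h2 : r ≤ N) :
    wt N p ((r : ℤ), c) =
      (if (p (r - 1) = p r + 1 ∧ p (r + 1) = p r + 1) ∧ p r = c then 1 else 0) -
      (if (p (r - 1) = p r - 1 ∧ p (r + 1) = p r - 1) ∧ p r = c then 1 else 0) := by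
  unfold wt
  rw [Finsupp.sub_apply, Finsupp.finset_sum_apply, Finsupp.finset_sum_apply]
  have hr : r ∈ Finset.Icc 1 N := by simp [h1, h2]
  rw [Finset.sum_eq_single_of_mem r hr, Finset.sum_eq_single_of_mem r hr]
  · congr 1
    · by_cases h : p (r - 1) = p r + 1 ∧ p (r + 1) = p r + 1
      · simp [h, Finsupp.single_apply]
      · simp [h]
    · by_cases h : p (r - 1) = p r - 1 ∧ p (r + 1) = p r - 1
      · simp [h, Finsupp.single_apply]
      · simp [h]
  all_goals
    intro b _ hb
    split_ifs
    · simp [Finsupp.single_apply, hb]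
    · rfl

lemma wt_stretch (i ib n : ℕ) (hi : 1 ≤ i) (hrel : n + 1 = i * (ib + 1)) (p g : ℕ → ℤ)
    (hS : ∀ j s : ℕ, j ≤ ib → s ≤ i →
      g (i * j + s) = (i : ℤ) * p j + s * (p (j + 1) - p j)) 
    (hp : ∀ r : ℕ, r ≤ ib → (p (r + 1) - p r = 1 ∨ p (r + 1) - p r = -1)) :
    wt n g = Finsupp.mapDomain (fS i) (wt ib p) := by
  have key : ∀ e : ℤ, (e = 1 ∨ e = -1) → 
    (∑ r ∈ Finset.Icc 1 n, if g (r - 1) = g r + e ∧ g (r + 1) = g r + e then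
        Finsupp.single ((r : ℤ), g r) (1 : ℤ) else 0) = 
    Finsupp.mapDomain.addMonoidHom (fS i) 
      (∑ r ∈ Finset.Icc 1 ib, if p (r - 1) = p r + e ∧ p (r + 1) = p r + e then
        Finsupp.single ((r : ℤ), p r) (1 : ℤ) else 0) := by
    intro e he
    rw [map_sum]
    have hinj : Set.InjOn (fun j => i * j) (Finset.Icc 1 ib : Set ℕ) := by
      intro x _ y _ h
      exact Nat.eq_of_mul_eq_mul_left hi h
    have hsub : (Finset.Icc 1 ib).image (fun j => i * j) ⊆ Finset.Icc 1 n := by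
      intro x hx
      simp only [Finset.mem_image, Finset.mem_Icc] at hx ⊢
      obtain ⟨j, hj, rfl⟩ := hx
      constructor
      · nlinarith
      · nlinarith
    rw [← Finset.sum_subset hsub, Finset.sum_image hinj]
    · apply Finset.sum_congr rfl
      intro j hj
      simp only [Finset.mem_Icc] at hj
      obtain ⟨j, rfl⟩ : ∃ j', j = j' + 1 := ⟨j - 1, by omega⟩
      have a1 := hS (j + 1) 0 (by omega) (by omega)
      have a2 := hS (j + 1) 1 (by omega) (by omega)
      have a3 := hS j (i - 1) (by omega) (by omega)
      have b1 := hp j (by omega)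
      have b2 := hp (j + 1) (by omega)
      have c1 : i * (j + 1) - 1 = i * j + (i - 1) := by
        rw [Nat.mul_add]; omega
      rw [← c1] at a3
      push_cast [Nat.cast_sub hi] at a1 a2 a3
      simp only [add_zero, zero_mul, one_mul] at a1 a2
      have a4 : g (i * (j + 1) - 1) = (i : ℤ) * p (j + 1) - (p (j + 1) - p j) := by
        rw [a3]; ring
      have hc : (g (i * (j + 1) - 1) = g (i * (j + 1)) + e ∧
          g (i * (j + 1) + 1) = g (i * (j + 1)) + e) ↔
          (p (j + 1 - 1) = p (j + 1) + e ∧ p (j + 1 + 1) = p (j + 1) + e) := by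
        rw [a1, a2, a4, Nat.add_sub_cancel]
        constructor <;> rintro ⟨h, h'⟩ <;> constructor <;> linarith
      simp only [hc]
      split_ifs
      · simp [Finsupp.mapDomain.addMonoidHom, Finsupp.mapDomain_single, fS, a1]
      · simp
    · intro r hr hr'
      simp only [Finset.mem_image, Finset.mem_Icc, not_exists, not_and] at hr hr'
      rw [if_neg]
      have hdm := Nat.div_add_mod r i
      have hlt := Nat.mod_lt r hi
      have hj : r / i ≤ ib := by
        have : r / i < ib + 1 := by
          rw [Nat.div_lt_iff_lt_mul hi, mul_comm]; omega
        omega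
      have hs : r % i ≠ 0 := by
        intro h0
        rw [h0] at hdm
        refine hr' (r / i) ⟨?_, hj⟩ hdm
        rcases Nat.eq_zero_or_pos (r / i) with h | h
        · rw [h] at hdm; omega
        · exact h
      obtain ⟨s, hs'⟩ : ∃ s, r % i = s + 1 := ⟨r % i - 1, by omega⟩
      have a1 := hS (r / i) s hj (by omega)
      have a2 := hS (r / i) (s + 1) hj (by omega)
      have a3 := hS (r / i) (s + 2) hj (by omega)
      rw [show i * (r / i) + s = r - 1 by omega] at a1
      rw [show i * (r / i) + (s + 1) = r by omega] at a2
      rw [show i * (r / i) + (s + 2) = r + 1 by omega] at a3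
      push_cast at a1 a2 a3
      rintro ⟨h, h'⟩
      have : 2 * e = 0 := by linear_combination (-h - h' + a1 - 2 * a2 + a3)
      omega
  have k1 := key 1 (Or.inl rfl)
  have k2 := key (-1) (Or.inr rfl)
  simp only [← sub_eq_add_neg] at k2
  unfold wt
  change _ = Finsupp.mapDomain.addMonoidHom (fS i) _
  rw [map_sub, k1, k2]

theorem stmt18 (i ib n : ℕ) (hi : 1 ≤ i) (hib : 1 ≤ ib) (hn : 1 ≤ n)
    (hrel : n + 1 = i * (ib + 1))
    (k : ℕ) (hk : 1 ≤ k) (idx : ℕ → ℕ) (a : ℕ → ℤ)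
    (hsnake : IsPrimeSnake ib k idx a)
    (Φ : ((ℤ × ℤ) →₀ ℤ) →+ ((ℤ × ℤ) →₀ ℤ))
    (hΦ : ∀ (j : ℕ) (c : ℤ), 1 ≤ j → j ≤ ib →
      Φ (Finsupp.single ((j : ℤ), c) 1) = Finsupp.single (((i * j : ℕ) : ℤ), (i : ℤ) * c) 1)
    (π : (ℤ × ℤ) →₀ ℤ) (hπ : ∀ x : ℤ × ℤ, π x ≠ 0 → 1 ≤ x.1 ∧ x.1 ≤ (ib : ℤ)) :
    (∃ p : ℕ → ℕ → ℤ, IsTuple ib k idx a p ∧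
        π = ∑ t ∈ Finset.Icc 1 k, wt ib (p t)) ↔
    (∃ g : ℕ → ℕ → ℤ, IsTuple n k (fun t => i * idx t) (fun t => (i : ℤ) * a t) g ∧
        Φ π = ∑ t ∈ Finset.Icc 1 k, wt n (g t)) := by
  have hi0 : (0 : ℤ) < i := by exact_mod_cast hi
  have hrelZ : (n : ℤ) + 1 = i * (ib + 1) := by exact_mod_cast hrel
  rw [Phi_eq i ib Φ hΦ π hπ]
  constructor
  · rintro ⟨p, ⟨hp1, hp2⟩, rfl⟩
    let g : ℕ → ℕ → ℤ := fun t m =>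
      (i : ℤ) * p t (m / i) + ((m % i : ℕ) : ℤ) * (p t (m / i + 1) - p t (m / i))
    have hS' : ∀ t j s : ℕ, s < i →
        g t (i * j + s) = (i : ℤ) * p t j + s * (p t (j + 1) - p t j) := by
      intro t j s hs
      simp only [g]
      rw [Nat.mul_add_div hi, Nat.mul_add_mod, Nat.mod_eq_of_lt hs, Nat.div_eq_of_lt hs, add_zero]
    have hS : ∀ t j s : ℕ, s ≤ i →
        g t (i * j + s) = (i : ℤ) * p t j + s * (p t (j + 1) - p t j) := by
      intro t j s hs
      rcases hs.lt_or_eq with h | rfl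
      · exact hS' t j s h
      · have := hS' t (j + 1) 0 (by omega)
        rw [show s * j + s = s * (j + 1) + 0 by ring, this]
        push_cast
        ring
    have dec : ∀ m : ℕ, m ≤ n → ∃ j s : ℕ, m = i * j + s ∧ s < i ∧ j ≤ ib := by
      intro m hm
      refine ⟨m / i, m % i, (Nat.div_add_mod m i).symm, Nat.mod_lt m hi, ?_⟩
      have : m / i < ib + 1 := by
        rw [Nat.div_lt_iff_lt_mul hi, mul_comm]; omega
      omega
    refine ⟨g, ⟨?_, ?_⟩, ?_⟩
    · intro t h1 h2
      obtain ⟨q1, q2, q3⟩ := hp1 t h1 h2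
      refine ⟨?_, ?_, ?_⟩
      · have := hS t 0 0 (by omega)
        simp only [mul_zero, add_zero] at this
        rw [this, q1]; push_cast; ring
      · have := hS t (ib + 1) 0 (by omega)
        simp only [add_zero] at this
        rw [hrel, this, q2]; push_cast; rw [hrelZ]; ring
      · intro r hr
        obtain ⟨j, s, rfl, hs, hj⟩ := dec r hr
        rw [add_assoc, hS t j (s + 1) hs, hS t j s hs.le]
        have := q3 j hj
        push_cast
        rcases this with h | h <;> rw [h]
        · left; ring
        · right; ring
    · intro t u h1 h2 h3 m hm
      rcases hm.lt_or_eq with h | rfl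
      · obtain ⟨j, s, rfl, hs, hj⟩ := dec m (by omega)
        rw [hS t j s hs.le, hS u j s hs.le]
        have b1 := hp2 t u h1 h2 h3 j (by omega)
        have b2 := hp2 t u h1 h2 h3 (j + 1) (by omega)
        have hs0 : (0 : ℤ) ≤ s := by positivity
        have hs1 : (0 : ℤ) < (i : ℤ) - s := by
          have : (s : ℤ) < i := by exact_mod_cast hs
          linarith
        have := mul_pos hs1 (sub_pos.2 b1)
        have := mul_nonneg hs0 (sub_pos.2 b2).le
        nlinarith
      · have e1 := hS t (ib + 1) 0 (by omega)
        have e2 := hS u (ib + 1) 0 (by omega)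
        have b := hp2 t u h1 h2 h3 (ib + 1) (by omega)
        simp only [add_zero] at e1 e2
        rw [hrel, e1, e2]
        push_cast
        nlinarith
    · change Finsupp.mapDomain.addMonoidHom (fS i) _ = _
      rw [map_sum]
      apply Finset.sum_congr rfl
      intro t ht
      simp only [Finset.mem_Icc] at ht
      exact (wt_stretch i ib n hi hrel (p t) (g t) (fun j s _ hs => hS t j s hs)
        (hp1 t ht.1 ht.2).2.2).symm
  · rintro ⟨g, ⟨hg1, hg2⟩, hw⟩
    -- no corner away from multiples of i
    have nc : ∀ t, 1 ≤ t → t ≤ k → ∀ r, 1 ≤ r → r ≤ n → ¬ i ∣ r →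
        g t (r + 1) - g t r = g t r - g t (r - 1) := by
      intro t h1 h2 r hr1 hr2 hd
      have hz := DFunLike.congr_fun hw ((r : ℤ), g t r)
      rw [Finsupp.mapDomain_notin_range, Finsupp.finset_sum_apply,
        Finset.sum_eq_single_of_mem t (by simp [h1, h2]), wt_apply n _ r _ hr1 hr2] at hz
      · have s1 := (hg1 t h1 h2).2.2 r hr2
        have s2 := (hg1 t h1 h2).2.2 (r - 1) (by omega)
        rw [Nat.sub_add_cancel hr1] at s2
        by_contra hne
        split_ifs at hz <;> omega
      · intro u hu hut
        simp only [Finset.mem_Icc] at hu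
        have hne : g u r ≠ g t r := by
          rcases lt_or_gt_of_ne hut with h | h
          · exact (hg2 u t hu.1 h h2 r (by omega)).ne
          · exact (hg2 t u h1 h hu.2 r (by omega)).ne'
        rw [wt_apply n _ r _ hr1 hr2]
        simp [hne]
      · rintro ⟨⟨x, y⟩, hx⟩
        simp only [fS, Prod.mk.injEq] at hx
        exact hd (Int.natCast_dvd_natCast.1 ⟨x, hx.1.symm⟩)
    have bnd : ∀ j s : ℕ, j ≤ ib → s < i → i * j + s ≤ n := by
      intro j s hj hs
      have : i * j ≤ i * ib := Nat.mul_le_mul_left i hj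
      rw [Nat.mul_add] at hrel
      omega
    have lin : ∀ t, 1 ≤ t → t ≤ k → ∀ j, j ≤ ib → ∀ s, s < i →
        g t (i * j + s + 1) - g t (i * j + s) = g t (i * j + 1) - g t (i * j) := by
      intro t h1 h2 j hj s
      induction s with
      | zero => intro _; rfl
      | succ s ih =>
        intro hs
        rw [← ih (by omega)]
        refine nc t h1 h2 (i * j + (s + 1)) (by omega) (bnd j _ hj hs) ?_
        intro hd
        have := (Nat.dvd_add_right (Dvd.intro j rfl)).1 hd
        have := Nat.le_of_dvd (by omega) this
        omega
    have lin2 : ∀ t, 1 ≤ t → t ≤ k → ∀ j, j ≤ ib → ∀ s, s ≤ i →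
        g t (i * j + s) = g t (i * j) + s * (g t (i * j + 1) - g t (i * j)) := by
      intro t h1 h2 j hj s
      induction s with
      | zero => intro _; simp
      | succ s ih =>
        intro hs
        have := ih (by omega)
        have := lin t h1 h2 j hj s (by omega)
        rw [← add_assoc]
        push_cast
        linarith
    let p : ℕ → ℕ → ℤ := fun t j => g t (i * j) / i
    have hpg : ∀ t, 1 ≤ t → t ≤ k → ∀ j, j ≤ ib + 1 → g t (i * j) = (i : ℤ) * p t j := by
      intro t h1 h2 j hj
      suffices h : (i : ℤ) ∣ g t (i * j) from (Int.mul_ediv_cancel' h).symm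
      induction j with
      | zero =>
        have := (hg1 t h1 h2).1
        rw [mul_zero, this]
        push_cast
        exact ⟨idx t + a t, by ring⟩
      | succ j ih =>
        rw [Nat.mul_add, mul_one, lin2 t h1 h2 j (by omega) i le_rfl]
        exact dvd_add (ih (by omega)) (Dvd.intro _ rfl)
    have hd : ∀ t, 1 ≤ t → t ≤ k → ∀ j, j ≤ ib →
        p t (j + 1) - p t j = g t (i * j + 1) - g t (i * j) := by
      intro t h1 h2 j hj
      have e1 := lin2 t h1 h2 j hj i le_rfl
      have e2 := hpg t h1 h2 (j + 1) (by omega)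
      have e3 := hpg t h1 h2 j (by omega)
      rw [Nat.mul_add, mul_one] at e2
      apply mul_left_cancel₀ hi0.ne'
      linarith
    have hst : ∀ t, 1 ≤ t → t ≤ k →
        ∀ r : ℕ, r ≤ ib → (p t (r + 1) - p t r = 1 ∨ p t (r + 1) - p t r = -1) := by
      intro t h1 h2 j hj
      rw [hd t h1 h2 j hj]
      exact (hg1 t h1 h2).2.2 _ (by simpa using bnd j 0 hj hi)
    refine ⟨p, ⟨?_, ?_⟩, ?_⟩
    · intro t h1 h2
      obtain ⟨q1, q2, q3⟩ := hg1 t h1 h2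
      refine ⟨?_, ?_, hst t h1 h2⟩
      · have := hpg t h1 h2 0 (by omega)
        rw [mul_zero, q1] at this
        apply mul_left_cancel₀ hi0.ne'
        push_cast at this
        linarith
      · have := hpg t h1 h2 (ib + 1) (by omega)
        rw [← hrel, q2] at this
        apply mul_left_cancel₀ hi0.ne'
        push_cast at this
        rw [← this, hrelZ]; ring
    · intro t u h1 h2 h3 m hm
      have e1 := hpg t h1 (by omega) m hm
      have e2 := hpg u (by omega) h3 m hm
      have := hg2 t u h1 h2 h3 (i * m) (by rw [hrel]; exact Nat.mul_le_mul_left i hm)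
      rw [e1, e2] at this
      exact lt_of_mul_lt_mul_left this hi0.le
    · apply Finsupp.mapDomain_injective (fS_inj i hi)
      rw [hw]
      change _ = Finsupp.mapDomain.addMonoidHom (fS i) _
      rw [map_sum]
      apply Finset.sum_congr rfl
      intro t ht
      simp only [Finset.mem_Icc] at ht
      refine wt_stretch i ib n hi hrel (p t) (g t) ?_ (hst t ht.1 ht.2)
      intro j s hj hs
      rw [lin2 t ht.1 ht.2 j hj s hs, hd t ht.1 ht.2 j hj, hpg t ht.1 ht.2 j (by omega)]
end
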